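/- Let n ≥ 1. No n-consistent Σₙ-definable extension of Robinson arithmetic Q is Πₙ-deciding: if T ⊇ Q is n-consistent and its set of (Gödel numbers of) axioms is definable in ℕ by a Σₙ-formula, then there exists a Πₙ-sentence γ with T ⊬ γ and T ⊬ ¬γ. -/

import Mathlib

/-!
Formalization of results from "Gödel–Rosser's Incompleteness Theorems for
non-RE Theories" (Salehi & Seraji).

We work in the first-order language of arithmetic `{0, S, +, ×, ≤}` with the
standard model `ℕ`.  Provability `T ⊢ φ` is rendered as the semantic
consequence `T ⊨ᵇ φ` of Mathlib's model theory library, which by the Gödel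
completeness theorem coincides with provability in first-order logic.
-/

open FirstOrder Language BoundedFormula

namespace GRNonRE

/-- Function symbols of arithmetic: `0`, `S`, `+`, `×`. -/
inductive ArithFunc : ℕ → Type
  | zero : ArithFunc 0
  | succ : ArithFunc 1
  | add  : ArithFunc 2
  | mul  : ArithFunc 2

/-- The relation symbol `≤`. -/
inductive ArithRel : ℕ → Type
  | le : ArithRel 2

/-- The first-order language of arithmetic `{0, S, +, ×, ≤}`. -/
def LA : FirstOrder.Language := ⟨ArithFunc, ArithRel⟩

/-- The standard model `ℕ`. -/
instance : LA.Structure ℕ where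
  funMap {_} f := match f with
    | ArithFunc.zero => fun _ => 0
    | ArithFunc.succ => fun v => v 0 + 1
    | ArithFunc.add  => fun v => v 0 + v 1
    | ArithFunc.mul  => fun v => v 0 * v 1
  RelMap {_} r := match r with
    | ArithRel.le => fun v => v 0 ≤ v 1

def zeroT {α : Type} : LA.Term α := Term.func ArithFunc.zero ![]
def succT {α : Type} (t : LA.Term α) : LA.Term α := Term.func ArithFunc.succ ![t]
def addT {α : Type} (t s : LA.Term α) : LA.Term α := Term.func ArithFunc.add ![t, s]
def mulT {α : Type} (t s : LA.Term α) : LA.Term α := Term.func ArithFunc.mul ![t, s]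

/-- The atomic formula `t ≤ s`. -/
def leF {α : Type} {n : ℕ} (t s : LA.Term (α ⊕ Fin n)) : LA.BoundedFormula α n :=
  BoundedFormula.rel ArithRel.le ![t, s]

/-- The numeral `m̄ = S (S ⋯ (S 0))` representing `m : ℕ`. -/
def numeral : ℕ → LA.Term Empty
  | 0 => zeroT
  | n + 1 => succT (numeral n)

instance : Encodable (Σ n, LA.Functions n) :=
  ⟨fun f => match f with
    | ⟨_, ArithFunc.zero⟩ => 0
    | ⟨_, ArithFunc.succ⟩ => 1
    | ⟨_, ArithFunc.add⟩ => 2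
    | ⟨_, ArithFunc.mul⟩ => 3,
   fun n => match n with
    | 0 => some ⟨0, ArithFunc.zero⟩
    | 1 => some ⟨1, ArithFunc.succ⟩
    | 2 => some ⟨2, ArithFunc.add⟩
    | 3 => some ⟨2, ArithFunc.mul⟩
    | _ => none,
   by rintro ⟨n, f⟩; cases f <;> rfl⟩

instance : Encodable (Σ n, LA.Relations n) :=
  ⟨fun _ => 0,
   fun n => match n with
    | 0 => some ⟨2, ArithRel.le⟩
    | _ => none,
   by rintro ⟨n, r⟩; cases r; rfl⟩

/-- A standard Gödel numbering of formulas, obtained from Mathlib's structural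
encoding of bounded formulas as lists of symbols. -/
def godel {k : ℕ} (φ : LA.BoundedFormula Empty k) : ℕ :=
  Encodable.encode φ.listEncode

/-- Lift a term in context `k` to context `k + 1`. -/
def liftT {k : ℕ} (t : LA.Term (Empty ⊕ Fin k)) : LA.Term (Empty ⊕ Fin (k + 1)) :=
  t.relabel (Sum.map id Fin.castSucc)

/-- The class `Σ₀ = Π₀ = Δ₀` of bounded formulas: built from atomic formulas by
Boolean connectives (`⊥` and `⟹`, from which `∼`, `⊓`, `⊔` are definable) and
bounded universal quantification `∀ x ≤ t, φ` (bounded existential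
quantification `∃ x ≤ t, φ` is expressible as `∼ ∀ x ≤ t, ∼φ`). -/
inductive Delta0 : ∀ {k : ℕ}, LA.BoundedFormula Empty k → Prop
  | falsum {k : ℕ} : Delta0 (⊥ : LA.BoundedFormula Empty k)
  | equal {k : ℕ} (t₁ t₂ : LA.Term (Empty ⊕ Fin k)) : Delta0 (t₁ =' t₂)
  | le {k : ℕ} (t₁ t₂ : LA.Term (Empty ⊕ Fin k)) : Delta0 (leF t₁ t₂)
  | imp {k : ℕ} {φ ψ : LA.BoundedFormula Empty k} :
      Delta0 φ → Delta0 ψ → Delta0 (φ ⟹ ψ)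
  | bdall {k : ℕ} (t : LA.Term (Empty ⊕ Fin k)) {φ : LA.BoundedFormula Empty (k + 1)} :
      Delta0 φ → Delta0 ((leF (&(Fin.last k)) (liftT t) ⟹ φ).all)

mutual
  /-- The classes `Σₙ` of the arithmetical hierarchy: `Σ₀` is the class of
  bounded formulas, and `Σ_{n+1}` contains `Πₙ` and is closed under `⊓`, `⊔`,
  existential quantification and bounded universal quantification. -/
  inductive IsSigma : ℕ → ∀ {k : ℕ}, LA.BoundedFormula Empty k → Prop
    | ofDelta0 {k : ℕ} {φ : LA.BoundedFormula Empty k} : Delta0 φ → IsSigma 0 φ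
    | ofPi {n k : ℕ} {φ : LA.BoundedFormula Empty k} :
        IsPi n φ → IsSigma (n + 1) φ
    | ex {n k : ℕ} {φ : LA.BoundedFormula Empty (k + 1)} :
        IsSigma (n + 1) φ → IsSigma (n + 1) φ.ex
    | inf {n k : ℕ} {φ ψ : LA.BoundedFormula Empty k} :
        IsSigma (n + 1) φ → IsSigma (n + 1) ψ → IsSigma (n + 1) (φ ⊓ ψ)
    | sup {n k : ℕ} {φ ψ : LA.BoundedFormula Empty k} :
        IsSigma (n + 1) φ → IsSigma (n + 1) ψ → IsSigma (n + 1) (φ ⊔ ψ)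
    | bdall {n k : ℕ} (t : LA.Term (Empty ⊕ Fin k))
        {φ : LA.BoundedFormula Empty (k + 1)} :
        IsSigma (n + 1) φ → IsSigma (n + 1) ((leF (&(Fin.last k)) (liftT t) ⟹ φ).all)

  /-- The classes `Πₙ` of the arithmetical hierarchy: `Π₀` is the class of
  bounded formulas, and `Π_{n+1}` contains `Σₙ` and is closed under `⊓`, `⊔`,
  universal quantification and bounded existential quantification. -/
  inductive IsPi : ℕ → ∀ {k : ℕ}, LA.BoundedFormula Empty k → Prop
    | ofDelta0 {k : ℕ} {φ : LA.BoundedFormula Empty k} : Delta0 φ → IsPi 0 φ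
    | ofSigma {n k : ℕ} {φ : LA.BoundedFormula Empty k} :
        IsSigma n φ → IsPi (n + 1) φ
    | all {n k : ℕ} {φ : LA.BoundedFormula Empty (k + 1)} :
        IsPi (n + 1) φ → IsPi (n + 1) φ.all
    | inf {n k : ℕ} {φ ψ : LA.BoundedFormula Empty k} :
        IsPi (n + 1) φ → IsPi (n + 1) ψ → IsPi (n + 1) (φ ⊓ ψ)
    | sup {n k : ℕ} {φ ψ : LA.BoundedFormula Empty k} :
        IsPi (n + 1) φ → IsPi (n + 1) ψ → IsPi (n + 1) (φ ⊔ ψ)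
    | bdex {n k : ℕ} (t : LA.Term (Empty ⊕ Fin k))
        {φ : LA.BoundedFormula Empty (k + 1)} :
        IsPi (n + 1) φ → IsPi (n + 1) ((leF (&(Fin.last k)) (liftT t) ⊓ φ).ex)
end

/-- `T ⊢ φ`: by the Gödel completeness theorem, provability of the sentence `φ`
from the theory `T` coincides with the semantic consequence relation. -/
def Proves (T : LA.Theory) (φ : LA.Sentence) : Prop := T ⊨ᵇ φ

/-- Consistency of a theory. -/
def Consistent (T : LA.Theory) : Prop := ¬ Proves T ⊥

/-- `ψ(m̄)`: the result of substituting the numeral `m̄` for the free variable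
of a formula `ψ(x)` with one free variable. -/
def subst1 (ψ : LA.BoundedFormula Empty 1) (m : ℕ) : LA.Sentence :=
  ψ.toFormula.subst fun _ => numeral m

/-- `n`-consistency: there is no formula `ψ(x) ∈ Π_{n-1}` such that `T ⊢ ¬ψ(m̄)`
for every numeral `m̄` (`m ∈ ℕ`) and yet `T ⊢ ∃x ψ(x)`.
(`0`-consistency is ordinary consistency.) -/
def NCon : ℕ → LA.Theory → Prop
  | 0, T => Consistent T
  | n + 1, T => ¬ ∃ ψ : LA.BoundedFormula Empty 1, IsPi n ψ ∧
      (∀ m : ℕ, Proves T (∼(subst1 ψ m))) ∧ Proves T ψ.ex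

/-- The axioms of Robinson arithmetic `Q`:
`Sx ≠ 0`, `Sx = Sy → x = y`, `x ≠ 0 → ∃y x = Sy`, `x + 0 = x`,
`x + Sy = S(x + y)`, `x·0 = 0`, `x·Sy = x·y + x`, `x ≤ y ↔ ∃z z + x = y`. -/
def QTheory : LA.Theory :=
  { ∀' ∼(succT (&0) =' zeroT),
    ∀' ∀' ((succT (&0) =' succT (&1)) ⟹ (&0 =' &1)),
    ∀' (∼(&0 =' zeroT) ⟹ ∃' (&0 =' succT (&1))),
    ∀' (addT (&0) zeroT =' &0),
    ∀' ∀' (addT (&0) (succT (&1)) =' succT (addT (&0) (&1))),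
    ∀' (mulT (&0) zeroT =' zeroT),
    ∀' ∀' (mulT (&0) (succT (&1)) =' addT (mulT (&0) (&1)) (&0)),
    ((leF (&0) (&1) ⇔ ∃' (addT (&2) (&0) =' (&1)) : LA.BoundedFormula Empty 2)).alls }

/-- `T` is an extension of Robinson arithmetic `Q` (i.e. `T` proves `Q`). -/
def ExtendsQ (T : LA.Theory) : Prop := ∀ φ ∈ QTheory, Proves T φ

/-- `Πₙ-Th(ℕ)`: the set of `Πₙ`-sentences true in the standard model. -/
def PiTh (n : ℕ) : LA.Theory := {φ | IsPi n φ ∧ ℕ ⊨ φ}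

/-- Soundness: every theorem of `T` is true in `ℕ`. -/
def Sound (T : LA.Theory) : Prop := ∀ φ : LA.Sentence, Proves T φ → ℕ ⊨ φ

/-- `Σₙ`-soundness: every `Σₙ`-sentence provable in `T` is true in `ℕ`. -/
def SigmaSound (n : ℕ) (T : LA.Theory) : Prop :=
  ∀ φ : LA.Sentence, IsSigma n φ → Proves T φ → ℕ ⊨ φ

/-- A formula `Ψ(x)` with one free variable defines the set `A ⊆ ℕ` in `ℕ`. -/
def Defines (Ψ : LA.BoundedFormula Empty 1) (A : Set ℕ) : Prop :=
  ∀ m : ℕ, m ∈ A ↔ Ψ.Realize (fun e => Empty.elim e) ![m]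

/-- `A ⊆ ℕ` is definable in `ℕ` by a `Σₙ`-formula. -/
def SigmaDefinable (n : ℕ) (A : Set ℕ) : Prop := ∃ Ψ, IsSigma n Ψ ∧ Defines Ψ A

/-- `A ⊆ ℕ` is definable in `ℕ` by a `Πₙ`-formula. -/
def PiDefinable (n : ℕ) (A : Set ℕ) : Prop := ∃ Ψ, IsPi n Ψ ∧ Defines Ψ A

/-- The set of Gödel numbers of the axioms of `T`. -/
def axiomCodes (T : LA.Theory) : Set ℕ := {m | ∃ φ ∈ T, godel φ = m}

/-- The set of Gödel numbers of the theorems of `T` (its deductive closure). -/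
def theoremCodes (T : LA.Theory) : Set ℕ := {m | ∃ φ, Proves T φ ∧ godel φ = m}

/-! ### Realization of terms and bounded formulas in arbitrary structures -/

section Structures

variable {M : Type} [LA.Structure M]

/-- The interpretation of `0`. -/
def zeroM : M := Structure.funMap (L := LA) ArithFunc.zero ![]

/-- The interpretation of the successor symbol. -/
def succM (x : M) : M := Structure.funMap (L := LA) ArithFunc.succ ![x]

/-- The interpretation of the addition symbol. -/
def addM (x y : M) : M := Structure.funMap (L := LA) ArithFunc.add ![x, y]

/-- The interpretation of the multiplication symbol. -/
def mulM (x y : M) : M := Structure.funMap (L := LA) ArithFunc.mul ![x, y]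

/-- The interpretation of the order symbol. -/
def leM (x y : M) : Prop := Structure.RelMap (L := LA) ArithRel.le ![x, y]

theorem realize_func_zero {α : Type} (v : α → M) (ts : Fin 0 → LA.Term α) :
    (Term.func (L := LA) ArithFunc.zero ts).realize v = zeroM :=
  congrArg (Structure.funMap (L := LA) ArithFunc.zero) (Subsingleton.elim _ _)

theorem realize_func_succ {α : Type} (v : α → M) (ts : Fin 1 → LA.Term α) :
    (Term.func (L := LA) ArithFunc.succ ts).realize v = succM ((ts 0).realize v) :=
  congrArg (Structure.funMap (L := LA) ArithFunc.succ) (by ext i; fin_cases i; rfl)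

theorem realize_func_add {α : Type} (v : α → M) (ts : Fin 2 → LA.Term α) :
    (Term.func (L := LA) ArithFunc.add ts).realize v =
      addM ((ts 0).realize v) ((ts 1).realize v) :=
  congrArg (Structure.funMap (L := LA) ArithFunc.add) (by ext i; fin_cases i <;> rfl)

theorem realize_func_mul {α : Type} (v : α → M) (ts : Fin 2 → LA.Term α) :
    (Term.func (L := LA) ArithFunc.mul ts).realize v =
      mulM ((ts 0).realize v) ((ts 1).realize v) :=
  congrArg (Structure.funMap (L := LA) ArithFunc.mul) (by ext i; fin_cases i <;> rfl)

@[simp] theorem realize_zeroT {α : Type} (v : α → M) : (zeroT : LA.Term α).realize v = zeroM :=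
  realize_func_zero _ _

@[simp] theorem realize_succT {α : Type} (v : α → M) (t : LA.Term α) :
    (succT t).realize v = succM (t.realize v) :=
  realize_func_succ _ _

@[simp] theorem realize_addT {α : Type} (v : α → M) (t s : LA.Term α) :
    (addT t s).realize v = addM (t.realize v) (s.realize v) :=
  realize_func_add _ _

@[simp] theorem realize_mulT {α : Type} (v : α → M) (t s : LA.Term α) :
    (mulT t s).realize v = mulM (t.realize v) (s.realize v) :=
  realize_func_mul _ _

theorem realize_rel_le {α : Type} {k : ℕ} (v : α → M) (w : Fin k → M)
    (ts : Fin 2 → LA.Term (α ⊕ Fin k)) :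
    (BoundedFormula.rel (L := LA) ArithRel.le ts).Realize v w ↔
      leM ((ts 0).realize (Sum.elim v w)) ((ts 1).realize (Sum.elim v w)) := by
  refine iff_of_eq (congrArg (Structure.RelMap (L := LA) ArithRel.le) ?_)
  ext i; fin_cases i <;> rfl

@[simp] theorem realize_leF {α : Type} {k : ℕ} (v : α → M) (w : Fin k → M)
    (t s : LA.Term (α ⊕ Fin k)) :
    (leF t s).Realize v w ↔ leM (t.realize (Sum.elim v w)) (s.realize (Sum.elim v w)) :=
  realize_rel_le _ _ _

@[simp] theorem realize_liftT {k : ℕ} (v : Empty → M) (w : Fin k → M) (x : M)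
    (t : LA.Term (Empty ⊕ Fin k)) :
    (liftT t).realize (Sum.elim v (Fin.snoc w x)) = t.realize (Sum.elim v w) := by
  rw [liftT, Term.realize_relabel]
  congr 1
  ext i
  rcases i with i | i <;> simp

/-- The element of a structure named by a numeral. -/
def std (m : ℕ) : M := (numeral m).realize (Empty.elim : Empty → M)

@[simp] theorem std_zero : (std 0 : M) = zeroM := realize_zeroT _

@[simp] theorem std_succ (m : ℕ) : (std (m + 1) : M) = succM (std m) := realize_succT _ _

end Structures

@[simp] theorem zeroM_nat : (zeroM : ℕ) = 0 := rfl
@[simp] theorem succM_nat (x : ℕ) : succM x = x + 1 := rfl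
@[simp] theorem addM_nat (x y : ℕ) : addM x y = x + y := rfl
@[simp] theorem mulM_nat (x y : ℕ) : mulM x y = x * y := rfl
@[simp] theorem leM_nat (x y : ℕ) : leM x y ↔ x ≤ y := Iff.rfl

/-- Substitution of terms for the free variables of a bounded formula yields a bounded formula. -/
theorem Delta0.exists_subst {k : ℕ} {φ : LA.BoundedFormula Empty k} (h : Delta0 φ) :
    ∀ {j : ℕ} (σ : Fin k → LA.Term (Empty ⊕ Fin j)),
      ∃ ψ : LA.BoundedFormula Empty j, Delta0 ψ ∧
        ∀ (M : Type) [LA.Structure M] (v : Empty → M) (w : Fin j → M),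
          ψ.Realize v w ↔ φ.Realize v fun i => (σ i).realize (Sum.elim v w) := by
  have term_subst : ∀ {k j : ℕ} (σ : Fin k → LA.Term (Empty ⊕ Fin j))
      (t : LA.Term (Empty ⊕ Fin k)), ∃ s : LA.Term (Empty ⊕ Fin j),
        ∀ (M : Type) [LA.Structure M] (v : Empty → M) (w : Fin j → M),
          s.realize (Sum.elim v w) =
            t.realize (Sum.elim v fun i => (σ i).realize (Sum.elim v w)) := by
    intro k j σ t
    refine ⟨t.subst (Sum.elim (fun e => e.elim) σ), fun M _ v w => ?_⟩
    rw [Term.realize_subst]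
    congr 1
    ext i
    rcases i with i | i
    · exact i.elim
    · rfl
  induction h with
  | falsum => exact fun σ => ⟨⊥, .falsum, fun M _ v w => Iff.rfl⟩
  | equal t₁ t₂ =>
    intro j σ
    obtain ⟨s₁, h₁⟩ := term_subst σ t₁
    obtain ⟨s₂, h₂⟩ := term_subst σ t₂
    exact ⟨s₁ =' s₂, .equal _ _, fun M _ v w => by simp [h₁, h₂]⟩
  | le t₁ t₂ =>
    intro j σ
    obtain ⟨s₁, h₁⟩ := term_subst σ t₁
    obtain ⟨s₂, h₂⟩ := term_subst σ t₂
    exact ⟨leF s₁ s₂, .le _ _, fun M _ v w => by simp [h₁, h₂]⟩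
  | imp _ _ ih₁ ih₂ =>
    intro j σ
    obtain ⟨ψ₁, d₁, h₁⟩ := ih₁ σ
    obtain ⟨ψ₂, d₂, h₂⟩ := ih₂ σ
    exact ⟨ψ₁ ⟹ ψ₂, .imp d₁ d₂, fun M _ v w => by simp [h₁, h₂]⟩
  | @bdall k t φ _ ih =>
    intro j σ
    obtain ⟨s, hs⟩ := term_subst σ t
    obtain ⟨ψ, d, hψ⟩ := ih (Fin.snoc (fun i => liftT (σ i)) (Term.var (Sum.inr (Fin.last j))))
    refine ⟨_, .bdall s d, fun M _ v w => ?_⟩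
    have key : ∀ x : M, (fun i => ((Fin.snoc (fun i => liftT (σ i))
        (Term.var (Sum.inr (Fin.last j))) :
        Fin (k + 1) → LA.Term (Empty ⊕ Fin (j + 1))) i).realize (Sum.elim v (Fin.snoc w x))) =
          Fin.snoc (fun i => (σ i).realize (Sum.elim v w)) x := by
      intro x
      ext i
      refine Fin.lastCases ?_ (fun i => ?_) i <;> simp
    simp [hψ, hs, key]

/-! ### Absoluteness of bounded formulas in models of Robinson arithmetic -/

section Robinson

variable {M : Type} [LA.Structure M]

/-- `M` satisfies the axioms of Robinson arithmetic, in unfolded form. -/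
structure IsQModel (M : Type) [LA.Structure M] : Prop where
  succ_ne_zero : ∀ x : M, succM x ≠ zeroM
  succ_inj : ∀ x y : M, succM x = succM y → x = y
  exists_pred : ∀ x : M, x ≠ zeroM → ∃ y, x = succM y
  add_zero : ∀ x : M, addM x zeroM = x
  add_succ : ∀ x y : M, addM x (succM y) = succM (addM x y)
  mul_zero : ∀ x : M, mulM x zeroM = zeroM
  mul_succ : ∀ x y : M, mulM x (succM y) = addM (mulM x y) x
  le_iff : ∀ x y : M, leM x y ↔ ∃ z, addM z x = y

theorem isQModel_of_realize (h : ∀ φ ∈ QTheory, M ⊨ φ) : IsQModel M := by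
  have snoc0 : ∀ x : M, (Fin.snoc (default : Fin 0 → M) x : Fin 1 → M) = ![x] := by
    intro x; ext i; fin_cases i; rfl
  have snoc1 : ∀ x y : M, (Fin.snoc ![x] y : Fin 2 → M) = ![x, y] := by
    intro x y; ext i; fin_cases i <;> rfl
  have snoc2 : ∀ x y z : M, (Fin.snoc ![x, y] z : Fin 3 → M) = ![x, y, z] := by
    intro x y z; ext i; fin_cases i <;> rfl
  simp only [QTheory, Set.mem_insert_iff, Set.mem_singleton_iff, forall_eq_or_imp,
    forall_eq] at h
  obtain ⟨h1, h2, h3, h4, h5, h6, h7, h8⟩ := h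
  rw [Sentence.Realize, BoundedFormula.realize_alls] at h8
  simp only [Sentence.Realize, Formula.Realize, realize_all, realize_not, realize_bdEqual,
    realize_succT, realize_zeroT, realize_addT, realize_mulT, realize_imp, realize_ex,
    snoc0, snoc1] at h1 h2 h3 h4 h5 h6 h7
  refine ⟨h1, h2, h3, h4, h5, h6, h7, fun x y => ?_⟩
  simpa [snoc2] using h8 ![x, y]

theorem std_add (hM : IsQModel M) (a b : ℕ) : (std (a + b) : M) = addM (std a) (std b) := by
  induction b with
  | zero => simp [hM.add_zero]
  | succ b ih => rw [← add_assoc, std_succ, std_succ, hM.add_succ, ih]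

theorem std_mul (hM : IsQModel M) (a b : ℕ) : (std (a * b) : M) = mulM (std a) (std b) := by
  induction b with
  | zero => simp [hM.mul_zero]
  | succ b ih => rw [Nat.mul_succ, std_succ, hM.mul_succ, std_add hM, ih]

theorem std_inj (hM : IsQModel M) : ∀ {a b : ℕ}, (std a : M) = std b → a = b
  | 0, 0, _ => rfl
  | 0, b + 1, h => absurd (by simpa using h.symm) (hM.succ_ne_zero (std b))
  | a + 1, 0, h => absurd (by simpa using h) (hM.succ_ne_zero (std a))
  | a + 1, b + 1, h => by
    rw [std_succ, std_succ] at h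
    rw [std_inj hM (hM.succ_inj _ _ h)]

theorem exists_std_of_le (hM : IsQModel M) {x : M} {b : ℕ} (h : leM x (std b)) :
    ∃ a ≤ b, x = std a := by
  induction b generalizing x with
  | zero =>
    obtain ⟨z, hz⟩ := (hM.le_iff _ _).1 h
    by_cases hx : x = zeroM
    · exact ⟨0, le_rfl, by simpa using hx⟩
    · obtain ⟨y, rfl⟩ := hM.exists_pred x hx
      rw [hM.add_succ, std_zero] at hz
      exact absurd hz (hM.succ_ne_zero _)
  | succ b ih =>
    obtain ⟨z, hz⟩ := (hM.le_iff _ _).1 h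
    by_cases hx : x = zeroM
    · exact ⟨0, Nat.zero_le _, by simpa using hx⟩
    · obtain ⟨y, rfl⟩ := hM.exists_pred x hx
      rw [hM.add_succ, std_succ] at hz
      obtain ⟨a, ha, rfl⟩ := ih ((hM.le_iff _ _).2 ⟨z, hM.succ_inj _ _ hz⟩)
      exact ⟨a + 1, by omega, (std_succ a).symm⟩

theorem std_le_std (hM : IsQModel M) {a b : ℕ} : leM (std a : M) (std b) ↔ a ≤ b := by
  constructor
  · intro h
    obtain ⟨c, hc, h'⟩ := exists_std_of_le hM h
    rwa [std_inj hM h']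
  · intro h
    refine (hM.le_iff _ _).2 ⟨std (b - a), ?_⟩
    rw [← std_add hM, Nat.sub_add_cancel h]

theorem realize_term_std (hM : IsQModel M) {k : ℕ} (v : Empty → M) (v' : Empty → ℕ) (w : Fin k → ℕ)
    (t : LA.Term (Empty ⊕ Fin k)) :
    t.realize (Sum.elim v fun i => std (w i)) = std (t.realize (Sum.elim v' w)) := by
  induction t with
  | var i =>
    rcases i with i | i
    · exact i.elim
    · rfl
  | func f ts ih =>
    cases f with
    | zero => rw [realize_func_zero, realize_func_zero]; exact std_zero.symm
    | succ => rw [realize_func_succ, realize_func_succ, ih]; exact (std_succ _).symm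
    | add => rw [realize_func_add, realize_func_add, ih, ih]; exact (std_add hM _ _).symm
    | mul => rw [realize_func_mul, realize_func_mul, ih, ih]; exact (std_mul hM _ _).symm

/-- Bounded formulas with standard parameters are absolute between `ℕ` and models of `Q`. -/
theorem Delta0.realize_std {k : ℕ} {φ : LA.BoundedFormula Empty k} (h : Delta0 φ)
    (hM : IsQModel M) (v : Empty → M) (v' : Empty → ℕ) (w : Fin k → ℕ) :
    φ.Realize v (fun i => std (w i)) ↔ φ.Realize v' w := by
  induction h with
  | falsum => exact Iff.rfl
  | equal t₁ t₂ =>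
    simp only [realize_bdEqual, realize_term_std hM v v']
    exact ⟨fun h => std_inj hM h, fun h => congrArg _ h⟩
  | le t₁ t₂ =>
    simp only [realize_leF, realize_term_std hM v v', std_le_std hM, leM_nat]
  | imp _ _ ih₁ ih₂ => simp only [realize_imp, ih₁, ih₂]
  | bdall t _ ih =>
    have key : ∀ a : ℕ, (Fin.snoc (fun i => std (w i)) (std a) : Fin _ → M) =
        fun i => std ((Fin.snoc w a : Fin _ → ℕ) i) := by
      intro a
      ext i
      refine Fin.lastCases ?_ (fun i => ?_) i <;> simp
    simp only [realize_all, realize_imp, realize_leF, realize_liftT, Function.comp_apply,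
      Term.realize_var, Sum.elim_inr, Fin.snoc_last, realize_term_std hM v v', leM_nat]
    constructor
    · intro H a ha
      rw [← ih, ← key]
      exact H _ ((std_le_std hM).2 ha)
    · intro H x hx
      obtain ⟨a, ha, rfl⟩ := exists_std_of_le hM hx
      rw [key, ih]
      exact H a ha

end Robinson

/-! ### Relations on `ℕ` definable by bounded and by `Σ₁` formulas -/

/-- A function on tuples of numbers that is the value of a term. -/
def PolyFn {k : ℕ} (f : (Fin k → ℕ) → ℕ) : Prop :=
  ∃ t : LA.Term (Empty ⊕ Fin k), ∀ v, t.realize (Sum.elim Empty.elim v) = f v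

namespace PolyFn

variable {k : ℕ} {f g : (Fin k → ℕ) → ℕ}

theorem proj (i : Fin k) : PolyFn fun v => v i := ⟨Term.var (Sum.inr i), fun _ => rfl⟩

theorem succ (hf : PolyFn f) : PolyFn fun v => f v + 1 :=
  let ⟨t, ht⟩ := hf
  ⟨succT t, fun v => by simp [ht]⟩

theorem const (m : ℕ) : PolyFn fun _ : Fin k → ℕ => m := by
  induction m with
  | zero => exact ⟨zeroT, fun v => by simp⟩
  | succ m ih => exact ih.succ

theorem add (hf : PolyFn f) (hg : PolyFn g) : PolyFn fun v => f v + g v :=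
  let ⟨t, ht⟩ := hf
  let ⟨s, hs⟩ := hg
  ⟨addT t s, fun v => by simp [ht, hs]⟩

theorem mul (hf : PolyFn f) (hg : PolyFn g) : PolyFn fun v => f v * g v :=
  let ⟨t, ht⟩ := hf
  let ⟨s, hs⟩ := hg
  ⟨mulT t s, fun v => by simp [ht, hs]⟩

end PolyFn

/-- A relation on `ℕ` defined by a bounded formula. -/
def BoundedRel {k : ℕ} (R : (Fin k → ℕ) → Prop) : Prop :=
  ∃ φ : LA.BoundedFormula Empty k, Delta0 φ ∧ ∀ v, φ.Realize Empty.elim v ↔ R v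

theorem snoc_init_last {k : ℕ} (w : Fin (k + 1) → ℕ) :
    (Fin.snoc (fun i => w i.castSucc) (w (Fin.last k)) : Fin (k + 1) → ℕ) = w :=
  Fin.snoc_init_self w

namespace BoundedRel

variable {k j : ℕ} {R S : (Fin k → ℕ) → Prop} {f g h : (Fin k → ℕ) → ℕ}

theorem congr (hR : BoundedRel R) (h : ∀ v, R v ↔ S v) : BoundedRel S :=
  let ⟨φ, d, hφ⟩ := hR
  ⟨φ, d, fun v => (hφ v).trans (h v)⟩

theorem imp (hR : BoundedRel R) (hS : BoundedRel S) : BoundedRel fun v => R v → S v :=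
  let ⟨φ, d, hφ⟩ := hR
  let ⟨ψ, e, hψ⟩ := hS
  ⟨φ ⟹ ψ, d.imp e, fun v => by simp [hφ, hψ]⟩

theorem not (hR : BoundedRel R) : BoundedRel fun v => ¬ R v :=
  hR.imp ⟨⊥, .falsum, fun _ => Iff.rfl⟩

theorem and (hR : BoundedRel R) (hS : BoundedRel S) : BoundedRel fun v => R v ∧ S v :=
  (hR.imp hS.not).not.congr fun v => by tauto

theorem or (hR : BoundedRel R) (hS : BoundedRel S) : BoundedRel fun v => R v ∨ S v :=
  (hR.not.imp hS).congr fun v => by tauto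

theorem eq (hf : PolyFn f) (hg : PolyFn g) : BoundedRel fun v => f v = g v :=
  let ⟨t, ht⟩ := hf
  let ⟨s, hs⟩ := hg
  ⟨t =' s, .equal _ _, fun v => by simp [ht, hs]⟩

theorem le (hf : PolyFn f) (hg : PolyFn g) : BoundedRel fun v => f v ≤ g v :=
  let ⟨t, ht⟩ := hf
  let ⟨s, hs⟩ := hg
  ⟨leF t s, .le _ _, fun v => by simp [ht, hs]⟩

theorem lt (hf : PolyFn f) (hg : PolyFn g) : BoundedRel fun v => f v < g v :=
  le hf.succ hg

theorem ball {R : (Fin k → ℕ) → ℕ → Prop} (hf : PolyFn f)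
    (hR : BoundedRel fun w : Fin (k + 1) → ℕ => R (fun i => w i.castSucc) (w (Fin.last k))) :
    BoundedRel fun v => ∀ x ≤ f v, R v x :=
  let ⟨t, ht⟩ := hf
  let ⟨φ, d, hφ⟩ := hR
  ⟨_, .bdall t d, fun v => by simp [ht, hφ]⟩

theorem bex {R : (Fin k → ℕ) → ℕ → Prop} (hf : PolyFn f)
    (hR : BoundedRel fun w : Fin (k + 1) → ℕ => R (fun i => w i.castSucc) (w (Fin.last k))) :
    BoundedRel fun v => ∃ x ≤ f v, R v x :=
  (ball (R := fun v x => ¬ R v x) hf hR.not).not.congr fun v => by push Not; rfl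

theorem subst {f : Fin k → (Fin j → ℕ) → ℕ} (hR : BoundedRel R) (hf : ∀ i, PolyFn (f i)) :
    BoundedRel fun v => R fun i => f i v := by
  obtain ⟨φ, d, hφ⟩ := hR
  choose σ hσ using hf
  obtain ⟨ψ, e, hψ⟩ := d.exists_subst σ
  refine ⟨ψ, e, fun v => ?_⟩
  rw [hψ, hφ]
  simp only [hσ]

theorem subst_snoc {R : (Fin k → ℕ) → ℕ → Prop}
    (hR : BoundedRel fun w : Fin (k + 1) → ℕ => R (fun i => w i.castSucc) (w (Fin.last k)))
    {f : Fin k → (Fin j → ℕ) → ℕ} {g : (Fin j → ℕ) → ℕ} (hf : ∀ i, PolyFn (f i))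
    (hg : PolyFn g) : BoundedRel fun v => R (fun i => f i v) (g v) := by
  refine (hR.subst (f := Fin.snoc f g) fun i => ?_).congr fun v => by simp
  refine Fin.lastCases ?_ (fun i => ?_) i <;> simp [hf, hg]

theorem pair_eq (hf : PolyFn f) (hg : PolyFn g) (hh : PolyFn h) :
    BoundedRel fun v => Nat.pair (f v) (g v) = h v :=
  (((lt hf hg).and (eq ((hg.mul hg).add hf) hh)).or
    ((le hg hf).and (eq (((hf.mul hf).add hf).add hg) hh))).congr fun v => by
      unfold Nat.pair
      split_ifs with H
      · simp [H]
      · simp [H, not_lt.1 H]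

theorem beta_eq_aux :
    BoundedRel fun v : Fin 3 → ℕ => Nat.beta (v 0) (v 1) = v 2 := by
  have : BoundedRel fun v : Fin 3 → ℕ => ∃ x ≤ v 0, ∃ y ≤ v 0, ∃ q ≤ v 0,
      Nat.pair x y = v 0 ∧ v 2 < (v 1 + 1) * y + 1 ∧ ((v 1 + 1) * y + 1) * q + v 2 = x := by
    refine bex (.proj _) (bex (.proj _) (bex (.proj _) ((pair_eq (.proj _) (.proj _) (.proj _)).and
      ((lt (.proj _) (((PolyFn.proj _).succ.mul (.proj _)).succ)).and (eq
        ((((PolyFn.proj _).succ.mul (.proj _)).succ.mul (.proj _)).add (.proj _)) (.proj _))))))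
  refine this.congr fun v => ⟨?_, ?_⟩
  · rintro ⟨x, -, y, -, q, -, h, hlt, rfl⟩
    rw [Nat.beta, ← h, Nat.unpair_pair, Nat.mul_add_mod, Nat.mod_eq_of_lt hlt]
  · intro h
    have hx := Nat.unpair_left_le (v 0)
    refine ⟨(v 0).unpair.1, hx, (v 0).unpair.2, Nat.unpair_right_le _,
      (v 0).unpair.1 / ((v 1 + 1) * (v 0).unpair.2 + 1), (Nat.div_le_self _ _).trans hx,
      Nat.pair_unpair _, ?_, ?_⟩
    · rw [← h]; exact Nat.mod_lt _ (Nat.succ_pos _)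
    · rw [← h]; exact Nat.div_add_mod _ _

theorem beta_eq (hf : PolyFn f) (hg : PolyFn g) (hh : PolyFn h) :
    BoundedRel fun v => Nat.beta (f v) (g v) = h v :=
  beta_eq_aux.subst (f := ![f, g, h]) fun i => by fin_cases i <;> assumption

end BoundedRel

/-- A relation on `ℕ` that is the projection of a relation defined by a bounded formula. -/
def SigmaOneRel {k : ℕ} (R : (Fin k → ℕ) → Prop) : Prop :=
  ∃ S : (Fin k → ℕ) → ℕ → Prop,
    (BoundedRel fun w : Fin (k + 1) → ℕ => S (fun i => w i.castSucc) (w (Fin.last k))) ∧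
      ∀ v, R v ↔ ∃ x, S v x

theorem BoundedRel.sigmaOneRel {k : ℕ} {R : (Fin k → ℕ) → Prop}
    (hR : BoundedRel R) : SigmaOneRel R :=
  ⟨fun v _ => R v, hR.subst fun i => .proj i.castSucc, fun v => by simp⟩

namespace SigmaOneRel

variable {k j : ℕ} {R S : (Fin k → ℕ) → Prop} {f g h : (Fin k → ℕ) → ℕ}

theorem congr (hR : SigmaOneRel R) (h : ∀ v, R v ↔ S v) : SigmaOneRel S :=
  let ⟨R', d, hR'⟩ := hR
  ⟨R', d, fun v => (h v).symm.trans (hR' v)⟩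

theorem subst {f : Fin k → (Fin j → ℕ) → ℕ} (hR : SigmaOneRel R) (hf : ∀ i, PolyFn (f i)) :
    SigmaOneRel fun v => R fun i => f i v := by
  obtain ⟨R', d, hR'⟩ := hR
  refine ⟨fun v x => R' (fun i => f i v) x, d.subst_snoc (fun i => ?_) (.proj _),
    fun v => hR' _⟩
  obtain ⟨t, ht⟩ := hf i
  exact ⟨liftT t, fun v => by rw [← snoc_init_last v, realize_liftT, ht, snoc_init_last v]⟩

theorem and (hR : SigmaOneRel R) (hS : SigmaOneRel S) : SigmaOneRel fun v => R v ∧ S v := by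
  obtain ⟨R', d, hR'⟩ := hR
  obtain ⟨S', e, hS'⟩ := hS
  refine ⟨fun v z => (∃ x ≤ z, R' v x) ∧ ∃ x ≤ z, S' v x,
    .and (.bex (.proj _) (d.subst_snoc (fun i => .proj i.castSucc.castSucc) (.proj _)))
      (.bex (.proj _) (e.subst_snoc (fun i => .proj i.castSucc.castSucc) (.proj _))),
    fun v => ?_⟩
  beta_reduce
  rw [hR', hS']
  constructor
  · rintro ⟨⟨x, hx⟩, y, hy⟩
    exact ⟨max x y, ⟨x, le_max_left _ _, hx⟩, y, le_max_right _ _, hy⟩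
  · rintro ⟨z, ⟨x, -, hx⟩, y, -, hy⟩
    exact ⟨⟨x, hx⟩, y, hy⟩

theorem or (hR : SigmaOneRel R) (hS : SigmaOneRel S) : SigmaOneRel fun v => R v ∨ S v := by
  obtain ⟨R', d, hR'⟩ := hR
  obtain ⟨S', e, hS'⟩ := hS
  exact ⟨fun v z => R' v z ∨ S' v z, d.or e, fun v => by beta_reduce; rw [hR', hS', exists_or]⟩

theorem ex {R : (Fin k → ℕ) → ℕ → Prop}
    (hR : SigmaOneRel fun w : Fin (k + 1) → ℕ => R (fun i => w i.castSucc) (w (Fin.last k))) :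
    SigmaOneRel fun v => ∃ x, R v x := by
  obtain ⟨R', d, hR'⟩ := hR
  refine ⟨fun v z => ∃ y ≤ z, ∃ x ≤ z, R' (Fin.snoc v y) x,
    .bex (.proj _) (.bex (.proj _) (d.subst_snoc
      (f := fun i w => (Fin.snoc (fun i => w i.castSucc.castSucc.castSucc)
        (w (Fin.last (k + 1)).castSucc) : Fin (k + 1) → ℕ) i) (fun i => ?_) (.proj _))),
    fun v => ?_⟩
  · refine Fin.lastCases ?_ (fun i => ?_) i
    · simpa using PolyFn.proj _
    · simpa using PolyFn.proj _
  · have key : ∀ y, R v y ↔ ∃ x, R' (Fin.snoc v y) x := fun y => by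
      simpa using hR' (Fin.snoc v y)
    simp only [key]
    constructor
    · rintro ⟨y, x, hx⟩
      exact ⟨max x y, y, le_max_right _ _, x, le_max_left _ _, hx⟩
    · rintro ⟨z, y, -, x, -, hx⟩
      exact ⟨y, x, hx⟩

theorem ball {R : (Fin k → ℕ) → ℕ → Prop} (hf : PolyFn f)
    (hR : SigmaOneRel fun w : Fin (k + 1) → ℕ => R (fun i => w i.castSucc) (w (Fin.last k))) :
    SigmaOneRel fun v => ∀ x ≤ f v, R v x := by
  obtain ⟨R', d, hR'⟩ := hR
  obtain ⟨t, ht⟩ := hf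
  refine ⟨fun v z => ∀ y ≤ f v, ∃ x ≤ z, R' (Fin.snoc v y) x,
    .ball ⟨liftT t, fun v => ?_⟩ (.bex (.proj _) (d.subst_snoc
      (f := fun i w => (Fin.snoc (fun i => w i.castSucc.castSucc.castSucc)
        (w (Fin.last (k + 1)).castSucc) : Fin (k + 1) → ℕ) i) (fun i => ?_) (.proj _))),
    fun v => ?_⟩
  · rw [← snoc_init_last v, realize_liftT, ht, snoc_init_last v]
  · refine Fin.lastCases ?_ (fun i => ?_) i
    · simpa using PolyFn.proj _
    · simpa using PolyFn.proj _
  · have key : ∀ y, R v y ↔ ∃ x, R' (Fin.snoc v y) x := fun y => by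
      simpa using hR' (Fin.snoc v y)
    simp only [key]
    constructor
    · intro H
      choose! X hX using H
      refine ⟨(Finset.range (f v + 1)).sup X, fun y hy => ⟨X y, ?_, hX y hy⟩⟩
      exact Finset.le_sup (Finset.mem_range.2 (by omega))
    · rintro ⟨z, hz⟩ y hy
      obtain ⟨x, -, hx⟩ := hz y hy
      exact ⟨x, hx⟩

end SigmaOneRel

/-- A function on `ℕ` whose graph is `Σ₁`. -/
def SigmaOneGraph (g : ℕ → ℕ) : Prop := SigmaOneRel fun v : Fin 2 → ℕ => g (v 0) = v 1

theorem SigmaOneGraph.rel {g : ℕ → ℕ} (hg : SigmaOneGraph g) {k : ℕ} {f h : (Fin k → ℕ) → ℕ}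
    (hf : PolyFn f) (hh : PolyFn h) : SigmaOneRel fun v => g (f v) = h v :=
  hg.subst (f := ![f, h]) fun i => by fin_cases i <;> assumption

theorem exists_beta_eq (F : ℕ → ℕ) (n : ℕ) : ∃ c, ∀ i ≤ n, Nat.beta c i = F i := by
  refine ⟨Nat.unbeta ((List.range (n + 1)).map F), fun i hi => ?_⟩
  have := Nat.beta_unbeta_coe ((List.range (n + 1)).map F) ⟨i, by simp; omega⟩
  simpa using this

theorem sigmaOneGraph_prec {f g : ℕ → ℕ} (hf : SigmaOneGraph f) (hg : SigmaOneGraph g) :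
    SigmaOneGraph (Nat.unpaired fun z n =>
      n.rec (f z) fun y IH => g (Nat.pair z (Nat.pair y IH))) := by
  have : SigmaOneRel fun v : Fin 2 → ℕ => ∃ z, ∃ n, ∃ c, Nat.pair z n = v 0 ∧
      (∃ a, f z = a ∧ Nat.beta c 0 = a) ∧
      (∀ i ≤ n, i = n ∨ ∃ a b p q, Nat.beta c i = a ∧ Nat.beta c (i + 1) = b ∧
        Nat.pair i a = p ∧ Nat.pair z p = q ∧ g q = b) ∧ Nat.beta c n = v 1 := by
    refine .ex <| .ex <| .ex <| .and
      (BoundedRel.pair_eq (.proj _) (.proj _) (.proj _)).sigmaOneRel <| .and ?_ <| .and ?_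
      (BoundedRel.beta_eq (.proj _) (.proj _) (.proj _)).sigmaOneRel
    · exact .ex <| .and (hf.rel (.proj _) (.proj _))
        (BoundedRel.beta_eq (.proj _) (.const 0) (.proj _)).sigmaOneRel
    · exact .ball (.proj _) <| .or (BoundedRel.eq (.proj _) (.proj _)).sigmaOneRel <|
        .ex <| .ex <| .ex <| .ex <|
          .and (BoundedRel.beta_eq (.proj _) (.proj _) (.proj _)).sigmaOneRel <|
          .and (BoundedRel.beta_eq (.proj _) (PolyFn.proj _).succ (.proj _)).sigmaOneRel <|
          .and (BoundedRel.pair_eq (.proj _) (.proj _) (.proj _)).sigmaOneRel <|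
          .and (BoundedRel.pair_eq (.proj _) (.proj _) (.proj _)).sigmaOneRel
            (hg.rel (.proj _) (.proj _))
  refine this.congr fun v => ⟨?_, ?_⟩
  · rintro ⟨z, n, c, hv, ⟨a, ha, hc⟩, H, hn⟩
    have key : ∀ i ≤ n, Nat.beta c i =
        (i.rec (f z) fun y IH => g (Nat.pair z (Nat.pair y IH)) : ℕ) := by
      intro i
      induction i with
      | zero => exact fun _ => hc.trans ha.symm
      | succ i ih =>
        intro hi
        rcases H i (by omega) with h | ⟨a, b, p, q, h1, h2, h3, h4, h5⟩
        · omega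
        · rw [h2, ← h5, ← h4, ← h3, ← h1, ih (by omega)]
    rw [← hv, Nat.unpaired, Nat.unpair_pair, ← hn]
    exact (key n le_rfl).symm
  · intro h
    obtain ⟨c, hc⟩ := exists_beta_eq (fun i =>
      (i.rec (f (v 0).unpair.1) fun y IH => g (Nat.pair (v 0).unpair.1 (Nat.pair y IH)) : ℕ))
      (v 0).unpair.2
    refine ⟨_, _, c, Nat.pair_unpair _, ⟨_, rfl, hc 0 (Nat.zero_le _)⟩, fun i hi => ?_,
      (hc _ le_rfl).trans h⟩
    rcases hi.eq_or_lt with h | h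
    · exact Or.inl h
    · refine Or.inr ⟨_, _, _, _, rfl, rfl, rfl, rfl, ?_⟩
      rw [hc i hi, hc (i + 1) h]

/-- Primitive recursive functions have `Σ₁` graphs. -/
theorem sigmaOneGraph_of_primrec {g : ℕ → ℕ} (hg : Nat.Primrec g) : SigmaOneGraph g := by
  induction hg with
  | zero => exact (BoundedRel.eq (.const 0) (.proj _)).sigmaOneRel
  | succ => exact (BoundedRel.eq (PolyFn.proj _).succ (.proj _)).sigmaOneRel
  | left =>
    refine (SigmaOneRel.ex (R := fun v b => Nat.pair (v 1) b = v 0)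
      (BoundedRel.pair_eq (.proj _) (.proj _) (.proj _)).sigmaOneRel).congr fun v => ⟨?_, ?_⟩
    · rintro ⟨b, hb⟩
      simp [← hb]
    · intro h
      exact ⟨(v 0).unpair.2, by rw [← h, Nat.pair_unpair]⟩
  | right =>
    refine (SigmaOneRel.ex (R := fun v b => Nat.pair b (v 1) = v 0)
      (BoundedRel.pair_eq (.proj _) (.proj _) (.proj _)).sigmaOneRel).congr fun v => ⟨?_, ?_⟩
    · rintro ⟨b, hb⟩
      simp [← hb]
    · intro h
      exact ⟨(v 0).unpair.1, by rw [← h, Nat.pair_unpair]⟩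
  | @pair f g _ _ hf hg =>
    refine (SigmaOneRel.ex (R := fun v a => ∃ b, f (v 0) = a ∧ g (v 0) = b ∧
      Nat.pair a b = v 1) (.ex (.and (hf.rel (.proj _) (.proj _)) (.and
        (hg.rel (.proj _) (.proj _))
        (BoundedRel.pair_eq (.proj _) (.proj _) (.proj _)).sigmaOneRel)))).congr fun v => ?_
    simp
  | @comp f g _ _ hf hg =>
    refine (SigmaOneRel.ex (R := fun v a => g (v 0) = a ∧ f a = v 1)
      (.and (hg.rel (.proj _) (.proj _)) (hf.rel (.proj _) (.proj _)))).congr fun v => ?_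
    simp
  | prec _ _ hf hg => exact sigmaOneGraph_prec hf hg

/-! ### The arithmetical hierarchy of predicates on `ℕ` -/

/-- The predicates obtained from a primitive recursive one by `n` alternations of negation and
unbounded existential quantification. -/
def SigmaPred : ℕ → (ℕ → Prop) → Prop
  | 0, p => PrimrecPred p
  | n + 1, p => ∃ q, SigmaPred n q ∧ ∀ m, p m ↔ ∃ y, ¬ q (Nat.pair m y)

namespace SigmaPred

variable {n : ℕ} {p q : ℕ → Prop}

theorem congr (hp : SigmaPred n p) (h : ∀ m, q m ↔ p m) : SigmaPred n q := by
  rwa [show q = p from funext fun m => propext (h m)]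

theorem comp {f : ℕ → ℕ} (hp : SigmaPred n p) (hf : Primrec f) :
    SigmaPred n fun m => p (f m) := by
  induction n generalizing p f with
  | zero => exact PrimrecPred.comp hp hf
  | succ n ih =>
    obtain ⟨q, hq, h⟩ := hp
    refine ⟨_, ih hq (f := fun z => Nat.pair (f z.unpair.1) z.unpair.2) ?_, fun m => ?_⟩
    · exact Primrec₂.natPair.comp (hf.comp (Primrec.fst.comp Primrec.unpair))
        (Primrec.snd.comp Primrec.unpair)
    · simp [h]

theorem not_succ (hp : SigmaPred n p) : SigmaPred (n + 1) fun m => ¬ p m :=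
  ⟨_, hp.comp (Primrec.fst.comp Primrec.unpair), fun m => by simp⟩

theorem succ (hp : SigmaPred n p) : SigmaPred (n + 1) p := by
  induction n generalizing p with
  | zero =>
    refine (not_succ (n := 0) (PrimrecPred.not hp)).congr fun m => not_not.symm
  | succ n ih =>
    obtain ⟨q, hq, h⟩ := hp
    exact ⟨q, ih hq, h⟩

theorem of_primrecPred (hp : PrimrecPred p) : SigmaPred n p := by
  induction n with
  | zero => exact hp
  | succ n ih => exact ih.succ

theorem ex (hp : SigmaPred (n + 1) p) : SigmaPred (n + 1) fun m => ∃ y, p (Nat.pair m y) := by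
  obtain ⟨q, hq, h⟩ := hp
  refine ⟨_, hq.comp (f := fun z => Nat.pair (Nat.pair z.unpair.1 z.unpair.2.unpair.1)
    z.unpair.2.unpair.2) ?_, fun m => ?_⟩
  · have h2 := Primrec.unpair.comp (Primrec.snd.comp Primrec.unpair)
    exact Primrec₂.natPair.comp (Primrec₂.natPair.comp (Primrec.fst.comp Primrec.unpair)
      (Primrec.fst.comp h2)) (Primrec.snd.comp h2)
  · simp only [h, Nat.unpair_pair]
    constructor
    · rintro ⟨y, x, hx⟩
      exact ⟨Nat.pair y x, by simpa using hx⟩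
    · rintro ⟨z, hz⟩
      exact ⟨_, _, hz⟩

theorem and_or (hp : SigmaPred n p) (hq : SigmaPred n q) :
    SigmaPred n (fun m => p m ∧ q m) ∧ SigmaPred n (fun m => p m ∨ q m) := by
  induction n generalizing p q with
  | zero => exact ⟨PrimrecPred.and hp hq, PrimrecPred.or hp hq⟩
  | succ n ih =>
    obtain ⟨p', hp', h⟩ := hp
    obtain ⟨q', hq', h'⟩ := hq
    refine ⟨?_, _, (ih hp' hq').1, fun m => ?_⟩
    · have h2 := Primrec.unpair.comp (Primrec.snd.comp Primrec.unpair)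
      refine ⟨_, (ih
        (hp'.comp (f := fun z => Nat.pair z.unpair.1 z.unpair.2.unpair.1) ?_)
        (hq'.comp (f := fun z => Nat.pair z.unpair.1 z.unpair.2.unpair.2) ?_)).2, fun m => ?_⟩
      · exact Primrec₂.natPair.comp (Primrec.fst.comp Primrec.unpair) (Primrec.fst.comp h2)
      · exact Primrec₂.natPair.comp (Primrec.fst.comp Primrec.unpair) (Primrec.snd.comp h2)
      · simp only [h, h', Nat.unpair_pair, not_or]
        constructor
        · rintro ⟨⟨y, hy⟩, x, hx⟩
          exact ⟨Nat.pair y x, by simpa using ⟨hy, hx⟩⟩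
        · rintro ⟨z, hz⟩
          exact ⟨⟨_, hz.1⟩, _, hz.2⟩
    · simp only [h, h', not_and_or, exists_or]

theorem and (hp : SigmaPred n p) (hq : SigmaPred n q) : SigmaPred n fun m => p m ∧ q m :=
  (and_or hp hq).1

theorem or (hp : SigmaPred n p) (hq : SigmaPred n q) : SigmaPred n fun m => p m ∨ q m :=
  (and_or hp hq).2

theorem forall_exists_mem_list {L : ℕ → List ℕ} (hL : Primrec L) (hp : SigmaPred n p) :
    SigmaPred n (fun m => ∀ x ∈ L m, p (Nat.pair m x)) ∧
      SigmaPred n (fun m => ∃ x ∈ L m, p (Nat.pair m x)) := by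
  induction n generalizing p L with
  | zero =>
    have hR : PrimrecRel fun x m => p (Nat.pair m x) :=
      PrimrecPred.comp hp (Primrec₂.natPair.comp Primrec.snd Primrec.fst)
    exact ⟨hR.forall_mem_list.comp hL Primrec.id, hR.exists_mem_list.comp hL Primrec.id⟩
  | succ n ih =>
    obtain ⟨q, hq, h⟩ := hp
    constructor
    · let W : ℕ → List ℕ := fun z => Denumerable.ofNat (List ℕ) z.unpair.2
      have hW : Primrec W := (Primrec.ofNat _).comp (Primrec.snd.comp Primrec.unpair)
      have hL' : Primrec fun z : ℕ => L z.unpair.1 :=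
        hL.comp (Primrec.fst.comp Primrec.unpair)
      have h1 : PrimrecPred fun z : ℕ => ∀ x ∈ L z.unpair.1, ∃ w ∈ W z, w.unpair.1 = x := by
        have hR : PrimrecRel fun (w : ℕ) (x : ℕ) => w.unpair.1 = x :=
          Primrec.eq.comp (Primrec.fst.comp (Primrec.unpair.comp Primrec.fst)) Primrec.snd
        have hR2 : PrimrecRel fun (x : ℕ) (z : ℕ) => ∃ w ∈ W z, w.unpair.1 = x :=
          hR.exists_mem_list.comp (hW.comp Primrec.snd) Primrec.fst
        exact hR2.forall_mem_list.comp hL' Primrec.id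
      have h2 : SigmaPred n fun z : ℕ => ∃ w ∈ W z,
          q (Nat.pair (Nat.pair z.unpair.1 w.unpair.1) w.unpair.2) := by
        refine ((ih hW (hq.comp (f := fun z => Nat.pair (Nat.pair z.unpair.1.unpair.1
          z.unpair.2.unpair.1) z.unpair.2.unpair.2) ?_)).2).congr fun z => by simp
        have h1 := Primrec.unpair.comp (Primrec.fst.comp Primrec.unpair)
        have h2 := Primrec.unpair.comp (Primrec.snd.comp Primrec.unpair)
        exact Primrec₂.natPair.comp (Primrec₂.natPair.comp (Primrec.fst.comp h1)
          (Primrec.fst.comp h2)) (Primrec.snd.comp h2)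
      refine ((of_primrecPred h1).and h2.not_succ).ex.congr fun m => ?_
      simp only [h, W, Nat.unpair_pair]
      constructor
      · intro H
        choose! f hf using H
        refine ⟨Encodable.encode ((L m).map fun x => Nat.pair x (f x)), ?_⟩
        simpa using hf
      · rintro ⟨z, hz, hz'⟩ x hx
        push Not at hz'
        obtain ⟨w, hw, rfl⟩ := hz x hx
        exact ⟨_, hz' w hw⟩
    · refine ⟨_, ((ih (L := fun z => L z.unpair.1) (hL.comp (Primrec.fst.comp Primrec.unpair))
        (hq.comp (f := fun z => Nat.pair (Nat.pair z.unpair.1.unpair.1 z.unpair.2)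
          z.unpair.1.unpair.2) ?_)).1), fun m => ?_⟩
      · have h1 := Primrec.unpair.comp (Primrec.fst.comp Primrec.unpair)
        exact Primrec₂.natPair.comp (Primrec₂.natPair.comp (Primrec.fst.comp h1)
          (Primrec.snd.comp Primrec.unpair)) (Primrec.snd.comp h1)
      · simp only [h, Nat.unpair_pair]
        push Not
        constructor
        · rintro ⟨x, hx, y, hy⟩
          exact ⟨y, x, hx, hy⟩
        · rintro ⟨y, x, hx, hy⟩
          exact ⟨x, hx, y, hy⟩

theorem forall_mem_list {L : ℕ → List ℕ} (hL : Primrec L) (hp : SigmaPred n p) :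
    SigmaPred n fun m => ∀ x ∈ L m, p (Nat.pair m x) :=
  (forall_exists_mem_list hL hp).1

theorem exists_universal (n : ℕ) : ∃ U, SigmaPred (n + 1) U ∧
    ∀ p, SigmaPred (n + 1) p → ∃ e, ∀ m, p m ↔ U (Nat.pair e m) := by
  induction n with
  | zero =>
    refine ⟨fun z => ∃ k, ¬ (Nat.Partrec.Code.evaln k
      (Denumerable.ofNat Nat.Partrec.Code z.unpair.1) z.unpair.2).isSome = false,
      ⟨fun z => (Nat.Partrec.Code.evaln z.unpair.2 (Denumerable.ofNat Nat.Partrec.Code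
        z.unpair.1.unpair.1) z.unpair.1.unpair.2).isSome = false, ?_, fun m => by simp⟩, ?_⟩
    · have h1 := Primrec.unpair.comp (Primrec.fst.comp Primrec.unpair)
      have := Nat.Partrec.Code.primrec_evaln.comp (((Primrec.snd.comp Primrec.unpair).pair
        ((Primrec.ofNat Nat.Partrec.Code).comp (Primrec.fst.comp h1))).pair (Primrec.snd.comp h1))
      exact Primrec.eq.comp (Primrec.option_isSome.comp this) (Primrec.const false)
    · rintro p ⟨q, hq, h⟩
      obtain ⟨dec, hq⟩ := hq
      have hpr : Partrec fun m => Nat.rfind fun y => Part.some (!decide (q (Nat.pair m y))) :=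
        Partrec.rfind (Primrec.to_comp (Primrec.not.comp (hq.comp Primrec₂.natPair)))
      obtain ⟨c, hc⟩ := Nat.Partrec.Code.exists_code.1 (Partrec.nat_iff.1 hpr)
      refine ⟨Encodable.encode c, fun m => ?_⟩
      have hdom : p m ↔ (c.eval m).Dom := by
        rw [hc, h]
        refine Iff.trans ?_ Nat.rfind_dom'.symm
        simp
      rw [hdom, Part.dom_iff_mem]
      simp only [Nat.unpair_pair, Denumerable.ofNat_encode, Nat.Partrec.Code.evaln_complete,
        Bool.not_eq_false, Option.isSome_iff_exists, Option.mem_def]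
      exact exists_comm
  | succ n ih =>
    obtain ⟨U, hU, huniv⟩ := ih
    refine ⟨fun z => ∃ y, ¬ U (Nat.pair z.unpair.1 (Nat.pair z.unpair.2 y)),
      ⟨_, hU.comp (f := fun z => Nat.pair z.unpair.1.unpair.1 (Nat.pair z.unpair.1.unpair.2
        z.unpair.2)) ?_, fun m => by simp⟩, ?_⟩
    · have h1 := Primrec.unpair.comp (Primrec.fst.comp Primrec.unpair)
      exact Primrec₂.natPair.comp (Primrec.fst.comp h1) (Primrec₂.natPair.comp
        (Primrec.snd.comp h1) (Primrec.snd.comp Primrec.unpair))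
    · rintro p ⟨q, hq, h⟩
      obtain ⟨e, he⟩ := huniv q hq
      exact ⟨e, fun m => by simp [h, he]⟩

/-- The hierarchy is strict. -/
theorem exists_not_compl (n : ℕ) :
    ∃ p, SigmaPred (n + 1) p ∧ ¬ SigmaPred (n + 1) fun m => ¬ p m := by
  obtain ⟨U, hU, huniv⟩ := exists_universal n
  refine ⟨fun m => U (Nat.pair m m), hU.comp (Primrec₂.natPair.comp Primrec.id Primrec.id),
    fun h => ?_⟩
  obtain ⟨e, he⟩ := huniv _ h
  exact not_iff_self (he e)

end SigmaPred

/-! ### Sets definable by `Σₙ` formulas -/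

/-- The `k`-tuple coded by a number. -/
def tupleOf : (k : ℕ) → ℕ → Fin k → ℕ
  | 0, _ => Fin.elim0
  | k + 1, m => Fin.snoc (tupleOf k m.unpair.1) m.unpair.2

theorem tupleOf_pair (k m x : ℕ) :
    tupleOf (k + 1) (Nat.pair m x) = Fin.snoc (tupleOf k m) x := by
  simp [tupleOf]

theorem primrec_tupleOf {k : ℕ} (i : Fin k) : Primrec fun m => tupleOf k m i := by
  induction k with
  | zero => exact i.elim0
  | succ k ih =>
    refine Fin.lastCases ?_ (fun i => ?_) i
    · simpa [tupleOf] using Primrec.snd.comp Primrec.unpair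
    · simpa [tupleOf] using (ih i).comp (Primrec.fst.comp Primrec.unpair)

theorem primrec_realize_term {k : ℕ} (t : LA.Term (Empty ⊕ Fin k)) :
    Primrec fun m => t.realize (Sum.elim Empty.elim (tupleOf k m) : Empty ⊕ Fin k → ℕ) := by
  induction t with
  | var a =>
    rcases a with a | i
    · exact a.elim
    · exact primrec_tupleOf i
  | func f ts ih =>
    cases f with
    | zero => exact Primrec.const 0
    | succ => exact Primrec.succ.comp (ih 0)
    | add => exact Primrec.nat_add.comp (ih 0) (ih 1)
    | mul => exact Primrec.nat_mul.comp (ih 0) (ih 1)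

theorem Delta0.primrecPred {k : ℕ} {φ : LA.BoundedFormula Empty k} (h : Delta0 φ) :
    PrimrecPred fun m => φ.Realize Empty.elim (tupleOf k m) := by
  induction h with
  | falsum => exact ⟨fun _ => .isFalse id, Primrec.const false⟩
  | equal t₁ t₂ =>
    exact (Primrec.eq.comp (primrec_realize_term t₁) (primrec_realize_term t₂)).of_eq
      fun m => by simp
  | le t₁ t₂ =>
    exact (Primrec.nat_le.comp (primrec_realize_term t₁) (primrec_realize_term t₂)).of_eq
      fun m => by simp
  | imp _ _ ih₁ ih₂ =>
    exact (ih₁.not.or ih₂).of_eq fun m => by rw [realize_imp]; tauto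
  | bdall t _ ih =>
    have hL := Primrec.list_range.comp (Primrec.succ.comp (primrec_realize_term t))
    refine PrimrecPred.of_eq (SigmaPred.forall_mem_list (n := 0) hL ih) fun m => ?_
    simp [tupleOf_pair]

theorem IsSigma.sigmaPred {n k : ℕ} {φ : LA.BoundedFormula Empty k} (h : IsSigma n φ) :
    SigmaPred n fun m => φ.Realize Empty.elim (tupleOf k m) := by
  refine IsSigma.rec
    (motive_1 := fun n k φ _ => SigmaPred n fun m => φ.Realize Empty.elim (tupleOf k m))
    (motive_2 := fun n k φ _ => SigmaPred n fun m => ¬ φ.Realize Empty.elim (tupleOf k m))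
    ?_ ?_ ?_ ?_ ?_ ?_ ?_ ?_ ?_ ?_ ?_ ?_ h
  · exact fun h => h.primrecPred
  · exact fun _ ih => ih.not_succ.congr fun m => not_not.symm
  · exact fun _ ih => ih.ex.congr fun m => by simp [tupleOf_pair]
  · exact fun _ _ ih₁ ih₂ => (ih₁.and ih₂).congr fun m => by simp
  · exact fun _ _ ih₁ ih₂ => (ih₁.or ih₂).congr fun m => by simp
  · intro n k t φ _ ih
    have hL := Primrec.list_range.comp (Primrec.succ.comp (primrec_realize_term t))
    exact (ih.forall_mem_list hL).congr fun m => by simp [tupleOf_pair]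
  · exact fun h => PrimrecPred.not h.primrecPred
  · exact fun _ ih => ih.not_succ
  · exact fun _ ih => ih.ex.congr fun m => by simp [tupleOf_pair]
  · exact fun _ _ ih₁ ih₂ => (ih₁.or ih₂).congr fun m => by
      rw [realize_inf, not_and_or]
  · exact fun _ _ ih₁ ih₂ => (ih₁.and ih₂).congr fun m => by simp
  · intro n k t φ _ ih
    have hL := Primrec.list_range.comp (Primrec.succ.comp (primrec_realize_term t))
    exact (ih.forall_mem_list hL).congr fun m => by simp [tupleOf_pair]

theorem SigmaDefinable.sigmaPred {n : ℕ} {A : Set ℕ} (h : SigmaDefinable n A) :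
    SigmaPred n fun m => m ∈ A := by
  obtain ⟨Ψ, hΨ, hA⟩ := h
  refine (hΨ.sigmaPred.comp (f := fun m => Nat.pair 0 m)
    (Primrec₂.natPair.comp (Primrec.const 0) Primrec.id)).congr fun m => (hA m).trans ?_
  rw [tupleOf_pair]
  have : (Fin.snoc (tupleOf 0 0) m : Fin 1 → ℕ) = ![m] := by
    funext i; fin_cases i; rfl
  rw [this, iff_iff_eq]

/-! ### Prenex formulas defining the predicates of the hierarchy -/

/-- `φ` and `φ'` are mutually dual formulas with `n` alternating unbounded quantifiers, `φ` being
`Σₙ` and `φ'` being `Πₙ`. -/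
inductive DualForms : ℕ → ∀ {k : ℕ}, LA.BoundedFormula Empty k → LA.BoundedFormula Empty k → Prop
  | base {k : ℕ} {φ : LA.BoundedFormula Empty k} : Delta0 φ → DualForms 0 φ (∼φ)
  | step {n k : ℕ} {φ φ' : LA.BoundedFormula Empty (k + 1)} :
      DualForms n φ φ' → DualForms (n + 1) φ'.ex φ.all

theorem Delta0.isSigma_isPi {k : ℕ} {φ : LA.BoundedFormula Empty k} (h : Delta0 φ) (n : ℕ) :
    IsSigma n φ ∧ IsPi n φ := by
  induction n with
  | zero => exact ⟨.ofDelta0 h, .ofDelta0 h⟩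
  | succ n ih => exact ⟨.ofPi ih.2, .ofSigma ih.1⟩

namespace DualForms

variable {n k : ℕ} {φ φ' : LA.BoundedFormula Empty k}

theorem isSigma_isPi (h : DualForms n φ φ') {m : ℕ} (hm : n ≤ m) : IsSigma m φ ∧ IsPi m φ' := by
  induction h generalizing m with
  | base h => exact ⟨(h.isSigma_isPi m).1, (Delta0.isSigma_isPi (h.imp .falsum) m).2⟩
  | step _ ih =>
    obtain ⟨m, rfl⟩ := Nat.exists_eq_add_of_lt hm
    obtain ⟨h₁, h₂⟩ := ih (Nat.le_add_right _ m)
    exact ⟨.ex (.ofPi h₂), .all (.ofSigma h₁)⟩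

theorem realize_iff_not (h : DualForms n φ φ') {M : Type} [LA.Structure M] (v : Empty → M)
    (w : Fin k → M) : φ'.Realize v w ↔ ¬ φ.Realize v w := by
  induction h with
  | base => exact realize_not
  | step _ ih => simp [ih]

theorem exists_subst (h : DualForms n φ φ') {j : ℕ} (σ : Fin k → LA.Term (Empty ⊕ Fin j)) :
    ∃ ψ ψ' : LA.BoundedFormula Empty j, DualForms n ψ ψ' ∧
      ∀ (M : Type) [LA.Structure M] (v : Empty → M) (w : Fin j → M),
        ψ.Realize v w ↔ φ.Realize v fun i => (σ i).realize (Sum.elim v w) := by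
  induction h generalizing j with
  | base h =>
    obtain ⟨ψ, d, hψ⟩ := h.exists_subst σ
    exact ⟨ψ, _, .base d, hψ⟩
  | step h ih =>
    obtain ⟨ψ, ψ', d, hψ⟩ :=
      ih (Fin.snoc (fun i => liftT (σ i)) (Term.var (Sum.inr (Fin.last j))))
    refine ⟨_, _, d.step, fun M _ v w => ?_⟩
    simp only [realize_ex, d.realize_iff_not, h.realize_iff_not, hψ]
    refine exists_congr fun x => not_congr (iff_of_eq (congrArg _ ?_))
    ext i
    refine Fin.lastCases ?_ (fun i => ?_) i <;> simp

end DualForms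

theorem SigmaOneRel.subst_snoc {k j : ℕ} {R : (Fin k → ℕ) → ℕ → Prop}
    (hR : SigmaOneRel fun w : Fin (k + 1) → ℕ => R (fun i => w i.castSucc) (w (Fin.last k)))
    {f : Fin k → (Fin j → ℕ) → ℕ} {g : (Fin j → ℕ) → ℕ} (hf : ∀ i, PolyFn (f i))
    (hg : PolyFn g) : SigmaOneRel fun v => R (fun i => f i v) (g v) := by
  refine (hR.subst (f := Fin.snoc f g) fun i => ?_).congr fun v => by simp
  refine Fin.lastCases ?_ (fun i => ?_) i <;> simp [hf, hg]

theorem SigmaPred.exists_dualForms_comp {n : ℕ} {p : ℕ → Prop} (hp : SigmaPred (n + 1) p) {k : ℕ}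
    {f : (Fin k → ℕ) → ℕ}
    (hf : SigmaOneRel fun w : Fin (k + 1) → ℕ => f (fun i => w i.castSucc) = w (Fin.last k)) :
    ∃ φ φ' : LA.BoundedFormula Empty k, DualForms (n + 1) φ φ' ∧
      ∀ v, φ.Realize Empty.elim v ↔ p (f v) := by
  induction n generalizing p k f with
  | zero =>
    obtain ⟨q, hq, h⟩ := hp
    obtain ⟨dec, hq⟩ := hq
    let χ : ℕ → ℕ := fun m => if q m then 1 else 0
    have hχ : Nat.Primrec χ := Primrec.nat_iff.1 <|
      (Primrec.cond hq (Primrec.const 1) (Primrec.const 0)).of_eq fun m => by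
        by_cases hm : q m <;> simp [χ, hm]
    have key : SigmaOneRel fun v => ∃ a y c, f v = a ∧ Nat.pair a y = c ∧ χ c = 0 :=
      .ex <| .ex <| .ex <| .and (hf.subst_snoc (R := fun v a => f v = a)
          (f := fun i w => w i.castSucc.castSucc.castSucc) (fun i => .proj _) (.proj _)) <|
        .and (BoundedRel.pair_eq (.proj _) (.proj _) (.proj _)).sigmaOneRel
          ((sigmaOneGraph_of_primrec hχ).rel (.proj _) (.const 0))
    obtain ⟨S, ⟨δ, d, hδ⟩, hS⟩ := key
    refine ⟨_, _, .step (.base (d.imp .falsum)), fun v => ?_⟩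
    have := hS v
    simp only [exists_and_left, exists_eq_left', χ, ite_eq_right_iff, one_ne_zero,
      imp_false] at this
    rw [h, this]
    simp [hδ]
  | succ n ih =>
    obtain ⟨q, hq, h⟩ := hp
    obtain ⟨φ, φ', d, hφ⟩ := ih hq (k := k + 1)
      (f := fun w => Nat.pair (f fun i => w i.castSucc) (w (Fin.last k))) <|
      (SigmaOneRel.ex (R := fun w a => f (fun i => w i.castSucc.castSucc) = a ∧
        Nat.pair a (w (Fin.last k).castSucc) = w (Fin.last (k + 1)))
        (.and (hf.subst_snoc (R := fun v a => f v = a)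
          (f := fun i w => w i.castSucc.castSucc.castSucc) (fun i => .proj _) (.proj _))
          (BoundedRel.pair_eq (.proj _) (.proj _) (.proj _)).sigmaOneRel)).congr
      fun w => by simp
    refine ⟨_, _, d.step, fun v => ?_⟩
    simp [d.realize_iff_not, hφ, h]

theorem SigmaPred.exists_dualForms {n : ℕ} {p : ℕ → Prop} (hp : SigmaPred (n + 1) p) :
    ∃ φ φ' : LA.BoundedFormula Empty 1, DualForms (n + 1) φ φ' ∧
      ∀ v, φ.Realize Empty.elim v ↔ p (v 0) :=
  hp.exists_dualForms_comp (BoundedRel.eq (.proj _) (.proj _)).sigmaOneRel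

/-! ### Deciding theories are correct on prenex formulas -/

theorem proves_iff {T : LA.Theory} {φ : LA.Sentence} :
    Proves T φ ↔ ∀ (M : Type) [LA.Structure M] [Nonempty M], M ⊨ T → M ⊨ φ := by
  rw [Proves, Theory.models_sentence_iff]
  exact ⟨fun h M _ _ hM => h (Theory.ModelType.of T M), fun h M => h M M.is_model⟩

theorem realize_subst1 {M : Type} [LA.Structure M] (ψ : LA.BoundedFormula Empty 1) (m : ℕ) :
    M ⊨ subst1 ψ m ↔ ψ.Realize Empty.elim fun _ => (std m : M) := by
  rw [Sentence.Realize, Formula.Realize, subst1, BoundedFormula.realize_subst]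
  refine (realize_toFormula ψ _).trans (iff_of_eq ?_)
  congr 1
  · exact Subsingleton.elim _ _
  · funext i
    exact congrArg (fun v : Empty → M => (numeral m).realize v) (Subsingleton.elim _ _)

/-- The numeral `m̄` as a term in context `k`. -/
def numeralIn (k m : ℕ) : LA.Term (Empty ⊕ Fin k) := (numeral m).relabel Sum.inl

@[simp] theorem realize_numeralIn {M : Type} [LA.Structure M] {k m : ℕ} (v : Empty → M)
    (w : Fin k → M) : (numeralIn k m).realize (Sum.elim v w) = std m := by
  rw [numeralIn, Term.realize_relabel]
  exact congrArg (fun v : Empty → M => (numeral m).realize v) (Subsingleton.elim _ _)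

theorem NCon.exists_model {n : ℕ} {T : LA.Theory} (h : NCon (n + 1) T) :
    ∃ (M : Type) (_ : LA.Structure M) (_ : Nonempty M), M ⊨ T := by
  by_contra H
  push Not at H
  refine h ⟨⊥, (Delta0.falsum.isSigma_isPi n).2, fun m => proves_iff.2 fun M _ _ hM => ?_,
    proves_iff.2 fun M _ _ hM => ?_⟩ <;>
  exact absurd hM (H M _ ‹_›)

theorem DualForms.realize_std {n : ℕ} {T : LA.Theory} (hQ : ExtendsQ T) (hcon : NCon (n + 1) T)
    (hdec : ∀ γ : LA.Sentence, IsPi (n + 1) γ → Proves T γ ∨ Proves T (∼γ)) {j k : ℕ}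
    {φ φ' : LA.BoundedFormula Empty k} (h : DualForms j φ φ') (hj : j ≤ n + 1) (v : Fin k → ℕ)
    (M : Type) [LA.Structure M] [Nonempty M] (hM : M ⊨ T) :
    (φ.Realize Empty.elim v → φ.Realize Empty.elim fun i => (std (v i) : M)) ∧
      (φ'.Realize Empty.elim v → φ'.Realize Empty.elim fun i => (std (v i) : M)) := by
  induction h generalizing M with
  | base d =>
    have hM' : IsQModel M := isQModel_of_realize fun φ hφ => proves_iff.1 (hQ φ hφ) M hM
    have := d.realize_std hM' Empty.elim Empty.elim v
    simp only [realize_not, this, imp_self, and_self]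
  | @step j k φ φ' h ih =>
    have hsnoc : ∀ {M : Type} [LA.Structure M] (a : ℕ),
        (Fin.snoc (fun i => std (v i)) (std a) : Fin (k + 1) → M) =
        fun i => std ((Fin.snoc v a : Fin (k + 1) → ℕ) i) := by
      intro M _ a
      ext i
      refine Fin.lastCases ?_ (fun i => ?_) i <;> simp
    constructor
    · rw [realize_ex, realize_ex]
      rintro ⟨a, ha⟩
      exact ⟨std a, by rw [hsnoc]; exact (ih (by omega) (Fin.snoc v a) M hM).2 ha⟩
    · intro H
      obtain ⟨ψ, ψ', d, hψ⟩ := h.step.exists_subst fun i => numeralIn 0 (v i)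
      obtain ⟨χ, χ', e, hχ⟩ := h.exists_subst
        (Fin.snoc (fun i => numeralIn 1 (v i)) (Term.var (Sum.inr 0)))
      have hψ' : ∀ (M : Type) [LA.Structure M],
          M ⊨ (ψ' : LA.Sentence) ↔ φ.all.Realize Empty.elim fun i => (std (v i) : M) := by
        intro M _
        have : ∀ w : Empty → M, w = Empty.elim := fun w => Subsingleton.elim _ _
        rw [Sentence.Realize, Formula.Realize, d.realize_iff_not, hψ,
          h.step.realize_iff_not, this default]
        simp
      have hχ' : ∀ (M : Type) [LA.Structure M] (x : M),
          χ'.Realize Empty.elim (fun _ => x) ↔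
            ¬ φ.Realize Empty.elim (Fin.snoc (fun i => (std (v i) : M)) x) := by
        intro M _ x
        rw [e.realize_iff_not, hχ]
        refine not_congr (iff_of_eq (congrArg _ ?_))
        ext i
        refine Fin.lastCases ?_ (fun i => ?_) i <;> simp
      rcases hdec ψ' (d.isSigma_isPi hj).2 with hp | hp
      · exact (hψ' M).1 (proves_iff.1 hp M hM)
      · refine absurd ⟨χ', (e.isSigma_isPi (Nat.le_of_succ_le_succ hj)).2, fun m => ?_, ?_⟩ hcon
        · refine proves_iff.2 fun M _ _ hM => ?_
          rw [Sentence.realize_not, realize_subst1, hχ', not_not, hsnoc]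
          exact (ih (by omega) (Fin.snoc v m) M hM).1 (realize_all.1 H m)
        · refine proves_iff.2 fun M _ _ hM => ?_
          have := proves_iff.1 hp M hM
          rw [Sentence.realize_not, hψ', realize_all, not_forall] at this
          obtain ⟨x, hx⟩ := this
          refine realize_ex.2 ⟨x, ?_⟩
          convert (hχ' M x).2 hx using 1
          funext i
          fin_cases i
          rfl

/-- Over a deciding theory, the complement of a predicate in the hierarchy is weakly represented
by a formula. -/
theorem SigmaPred.exists_represents_compl {n : ℕ} {T : LA.Theory} (hQ : ExtendsQ T)
    (hcon : NCon (n + 1) T)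
    (hdec : ∀ γ : LA.Sentence, IsPi (n + 1) γ → Proves T γ ∨ Proves T (∼γ)) {p : ℕ → Prop}
    (hp : SigmaPred (n + 1) p) : ∃ U : LA.BoundedFormula Empty 1, ∀ m,
      (¬ p m ↔ ∀ (M : Type) [LA.Structure M] [Nonempty M], M ⊨ T →
        U.Realize Empty.elim fun _ => (std m : M)) := by
  obtain ⟨φ, φ', d, hφ⟩ := hp.exists_dualForms
  refine ⟨φ', fun m => ⟨fun hm M _ _ hM => ?_, fun H hm => ?_⟩⟩
  · refine (d.realize_std hQ hcon hdec le_rfl (fun _ => m) M hM).2 ?_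
    rwa [d.realize_iff_not, hφ]
  · obtain ⟨M, _, _, hM⟩ := hcon.exists_model
    exact (d.realize_iff_not _ _).1 (H M hM)
      ((d.realize_std hQ hcon hdec le_rfl (fun _ => m) M hM).1 ((hφ _).2 hm))

/-! ### Unsatisfiability of recursive sets of propositional clauses -/

theorem exists_finite_unsat {I : Set ℕ} {C : ℕ → List (ℕ × Bool)}
    (h : ¬ ∃ v : ℕ → Bool, ∀ j ∈ I, ∃ l ∈ C j, v l.1 = l.2) :
    ∃ F : List ℕ, (∀ j ∈ F, j ∈ I) ∧
      ∀ v : ℕ → Bool, ∃ j ∈ F, ∀ l ∈ C j, v l.1 ≠ l.2 := by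
  push Not at h
  have hopen : ∀ j : I, IsOpen {v : ℕ → Bool | ∀ l ∈ C j, v l.1 ≠ l.2} := by
    intro j
    have : {v : ℕ → Bool | ∀ l ∈ C j, v l.1 ≠ l.2} =
        ⋂ l ∈ (C j).toFinset, {v : ℕ → Bool | v l.1 ≠ l.2} := by
      ext v; simp
    rw [this]
    refine isOpen_biInter_finset fun l _ => ?_
    exact isOpen_ne.preimage (continuous_apply (A := fun _ : ℕ => Bool) l.1)
  obtain ⟨t, ht⟩ := isCompact_univ.elim_finite_subcover _ hopen fun v _ => by
    obtain ⟨j, hj, hv⟩ := h v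
    exact Set.mem_iUnion.2 ⟨⟨j, hj⟩, hv⟩
  refine ⟨t.toList.map Subtype.val, ?_, fun v => ?_⟩
  · simp only [List.mem_map]
    rintro _ ⟨j, -, rfl⟩
    exact j.2
  · obtain ⟨j, hj, hv⟩ := Set.mem_iUnion₂.1 (ht (Set.mem_univ v))
    exact ⟨j, by simpa using hj, hv⟩

theorem not_exists_sat_iff {I : Set ℕ} {C : ℕ → List (ℕ × Bool)} :
    (¬ ∃ v : ℕ → Bool, ∀ j ∈ I, ∃ l ∈ C j, v l.1 = l.2) ↔
      ∃ (F : List ℕ) (N : ℕ), (∀ j ∈ F, j ∈ I) ∧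
        ∀ b < 2 ^ N, ∃ j ∈ F, ∀ l ∈ C j, l.1 < N ∧ b.testBit l.1 ≠ l.2 := by
  constructor
  · intro h
    obtain ⟨F, hF, hv⟩ := exists_finite_unsat h
    refine ⟨F, (F.flatMap fun j => (C j).map fun l => l.1).sum + 1, hF, fun b _ => ?_⟩
    obtain ⟨j, hj, hl⟩ := hv b.testBit
    refine ⟨j, hj, fun l hl' => ⟨Nat.lt_succ_of_le (List.le_sum_of_mem ?_), hl l hl'⟩⟩
    simp only [List.mem_flatMap, List.mem_map]
    exact ⟨j, hj, l, hl', rfl⟩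
  · rintro ⟨F, N, hF, H⟩ ⟨v, hv⟩
    obtain ⟨j, hj, hl⟩ := H (Nat.ofBits fun i : Fin N => v i) (Nat.ofBits_lt_two_pow _)
    obtain ⟨l, hlC, hvl⟩ := hv j (hF j hj)
    obtain ⟨hN, hne⟩ := hl l hlC
    rw [Nat.testBit_ofBits_lt _ _ hN] at hne
    exact hne hvl

theorem primrec_testBit : Primrec₂ Nat.testBit := by
  have hpow : Primrec₂ fun a b : ℕ => a ^ b := Primrec₂.unpaired'.1 Nat.Primrec.pow
  have : PrimrecPred fun x : ℕ × ℕ => x.1 / 2 ^ x.2 % 2 = 1 :=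
    Primrec.eq.comp (Primrec.nat_mod.comp (Primrec.nat_div.comp Primrec.fst
      (hpow.comp (Primrec.const 2) Primrec.snd)) (Primrec.const 2)) (Primrec.const 1)
  exact this.decide.of_eq fun x => (Nat.testBit_eq_decide_div_mod_eq).symm

/-- The set of parameters for which a recursive family of clauses is unsatisfiable, when part of
the clauses is guarded by a predicate of the hierarchy. -/
theorem SigmaPred.not_exists_sat {n : ℕ} {A : ℕ → Prop} (hA : SigmaPred (n + 1) A)
    {C : ℕ → ℕ → List (ℕ × Bool)} (hC : Primrec₂ C) :
    SigmaPred (n + 1) fun m => ¬ ∃ v : ℕ → Bool,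
      ∀ j ∈ {j : ℕ | j.unpair.2 = 0 → A j.unpair.1}, ∃ l ∈ C m j, v l.1 = l.2 := by
  have hpow : Primrec₂ fun a b : ℕ => a ^ b := Primrec₂.unpaired'.1 Nat.Primrec.pow
  have hlit : PrimrecRel fun (l : ℕ × Bool) (x : ℕ × ℕ) =>
      l.1 < x.2 ∧ x.1.testBit l.1 ≠ l.2 :=
    PrimrecPred.and
      (Primrec.nat_lt.comp (Primrec.fst.comp Primrec.fst) (Primrec.snd.comp Primrec.snd))
      (Primrec.eq.comp (primrec_testBit.comp (Primrec.fst.comp Primrec.snd)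
        (Primrec.fst.comp Primrec.fst)) (Primrec.snd.comp Primrec.fst)).not
  have hclause : PrimrecRel fun (j : ℕ) (x : ℕ × ℕ × ℕ) =>
      ∀ l ∈ C x.1 j, l.1 < x.2.2 ∧ x.2.1.testBit l.1 ≠ l.2 :=
    hlit.forall_mem_list.comp
      (hC.comp (Primrec.fst.comp Primrec.snd) Primrec.fst) (Primrec.snd.comp Primrec.snd)
  have hexists : PrimrecRel fun (b : ℕ) (x : ℕ × List ℕ × ℕ) =>
      ∃ j ∈ x.2.1, ∀ l ∈ C x.1 j, l.1 < x.2.2 ∧ b.testBit l.1 ≠ l.2 :=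
    hclause.exists_mem_list.comp (Primrec.fst.comp (Primrec.snd.comp Primrec.snd))
      ((Primrec.fst.comp Primrec.snd).pair (Primrec.fst.pair
        (Primrec.snd.comp (Primrec.snd.comp Primrec.snd))))
  let F : ℕ → List ℕ := fun z => Denumerable.ofNat (List ℕ) z.unpair.2.unpair.1
  have h2 := Primrec.unpair.comp (Primrec.snd.comp Primrec.unpair)
  have hF : Primrec F := (Primrec.ofNat _).comp (Primrec.fst.comp h2)
  have hcheck : PrimrecPred fun z : ℕ => ∀ b < 2 ^ z.unpair.2.unpair.2, ∃ j ∈ F z,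
      ∀ l ∈ C z.unpair.1 j, l.1 < z.unpair.2.unpair.2 ∧ b.testBit l.1 ≠ l.2 :=
    (hexists.forall_mem_list.comp
      (Primrec.list_range.comp (hpow.comp (Primrec.const 2) (Primrec.snd.comp h2)))
      ((Primrec.fst.comp Primrec.unpair).pair (hF.pair (Primrec.snd.comp h2)))).of_eq
        fun z => by simp only [List.mem_range]
  have hguard : SigmaPred (n + 1) fun z : ℕ => ∀ j ∈ F z,
      j.unpair.2 ≠ 0 ∨ A j.unpair.1 := by
    refine (forall_mem_list hF ((of_primrecPred (p := fun z => z.unpair.2.unpair.2 ≠ 0)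
      (Primrec.eq.comp (Primrec.snd.comp h2) (Primrec.const 0)).not).or
      (hA.comp (Primrec.fst.comp h2)))).congr fun z => by simp
  refine (hguard.and (of_primrecPred hcheck)).ex.congr fun m => ?_
  rw [not_exists_sat_iff]
  constructor
  · rintro ⟨L, N, h₁, h₂⟩
    refine ⟨Nat.pair (Encodable.encode L) N, ?_⟩
    simp only [F, Nat.unpair_pair, Denumerable.ofNat_encode]
    exact ⟨fun j hj => not_or_of_imp (h₁ j hj), h₂⟩
  · rintro ⟨y, h₁, h₂⟩
    simp only [F, Nat.unpair_pair] at h₁ h₂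
    exact ⟨_, _, fun j hj h => (h₁ j hj).resolve_left (not_not.2 h), h₂⟩

/-! ### Numerical codes of terms and formulas -/

/-- Interpretations of the function symbols of arithmetic on a type. -/
structure ArithOps (D : Type) where
  zero : D
  succ : D → D
  add : D → D → D
  mul : D → D → D

def tmVar (i : ℕ) : ℕ := Nat.pair i 0
def tmZero : ℕ := Nat.pair 0 1
def tmSucc (a : ℕ) : ℕ := Nat.pair a 2
def tmAdd (a b : ℕ) : ℕ := Nat.pair (Nat.pair a b) 3
def tmMul (a b : ℕ) : ℕ := Nat.pair (Nat.pair a b) 4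
def fmFal (k : ℕ) : ℕ := Nat.pair k 0
def fmEq (k a b : ℕ) : ℕ := Nat.pair (Nat.pair k (Nat.pair a b)) 1
def fmLe (k a b : ℕ) : ℕ := Nat.pair (Nat.pair k (Nat.pair a b)) 2
def fmImp (a b : ℕ) : ℕ := Nat.pair (Nat.pair a b) 3
def fmAll (a : ℕ) : ℕ := Nat.pair a 4

theorem unpair_fst_lt {t : ℕ} (h : t.unpair.2 ≠ 0) : t.unpair.1 < t :=
  Nat.unpair_lt (Nat.one_le_iff_ne_zero.2 fun h0 => h (by simp [h0]))

theorem unpair_fst_fst_lt {t : ℕ} (h : t.unpair.2 ≠ 0) : t.unpair.1.unpair.1 < t :=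
  (Nat.unpair_left_le _).trans_lt (unpair_fst_lt h)

theorem unpair_fst_snd_lt {t : ℕ} (h : t.unpair.2 ≠ 0) : t.unpair.1.unpair.2 < t :=
  (Nat.unpair_right_le _).trans_lt (unpair_fst_lt h)

/-- The value of the term coded by `t` in the environment `s`. -/
def ArithOps.val {D : Type} (o : ArithOps D) (s : List D) (t : ℕ) : D :=
  if t.unpair.2 = 0 then s.getD t.unpair.1 o.zero
  else if t.unpair.2 = 1 then o.zero
  else if t.unpair.2 = 2 then o.succ (o.val s t.unpair.1)
  else if t.unpair.2 = 3 then
    o.add (o.val s t.unpair.1.unpair.1) (o.val s t.unpair.1.unpair.2)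
  else o.mul (o.val s t.unpair.1.unpair.1) (o.val s t.unpair.1.unpair.2)
termination_by t
decreasing_by
  all_goals first
    | exact unpair_fst_lt ‹_›
    | exact unpair_fst_fst_lt ‹_›
    | exact unpair_fst_snd_lt ‹_›

namespace ArithOps

variable {D : Type} (o : ArithOps D) (s : List D)

@[simp] theorem val_tmVar (i : ℕ) : o.val s (tmVar i) = s.getD i o.zero := by
  rw [val]; simp [tmVar]

@[simp] theorem val_tmZero : o.val s tmZero = o.zero := by
  rw [val]; simp [tmZero]

@[simp] theorem val_tmSucc (a : ℕ) : o.val s (tmSucc a) = o.succ (o.val s a) := by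
  rw [val]; simp [tmSucc]

@[simp] theorem val_tmAdd (a b : ℕ) : o.val s (tmAdd a b) = o.add (o.val s a) (o.val s b) := by
  rw [val]; simp [tmAdd]

@[simp] theorem val_tmMul (a b : ℕ) : o.val s (tmMul a b) = o.mul (o.val s a) (o.val s b) := by
  rw [val]; simp [tmMul]

/-- A map commuting with the interpretations of the function symbols. -/
structure IsHom {E : Type} (o : ArithOps D) (o' : ArithOps E) (e : D → E) : Prop where
  zero : e o.zero = o'.zero
  succ : ∀ x, e (o.succ x) = o'.succ (e x)
  add : ∀ x y, e (o.add x y) = o'.add (e x) (e y)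
  mul : ∀ x y, e (o.mul x y) = o'.mul (e x) (e y)

variable {o} in
theorem IsHom.map_val {E : Type} {o' : ArithOps E} {e : D → E} (h : IsHom o o' e) (t : ℕ) :
    e (o.val s t) = o'.val (s.map e) t := by
  induction t using Nat.strong_induction_on with
  | _ t ih =>
    conv_lhs => rw [val]
    conv_rhs => rw [val]
    by_cases h0 : t.unpair.2 = 0
    · simp only [h0, if_true]
      rw [← h.zero, List.getD_map]
    · have h1 := ih _ (unpair_fst_lt h0)
      have h2 := ih _ (unpair_fst_fst_lt h0)
      have h3 := ih _ (unpair_fst_snd_lt h0)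
      simp only [h0, if_false]
      split_ifs <;> simp [h.zero, h.succ, h.add, h.mul, h1, h2, h3]

end ArithOps

/-- The operations of a structure. -/
def opsOf (M : Type) [LA.Structure M] : ArithOps M := ⟨zeroM, succM, addM, mulM⟩

/-- Satisfaction of the formula coded by `c` in the environment `s`. -/
def Sat {M : Type} [LA.Structure M] (c : ℕ) (s : List M) : Prop :=
  if c.unpair.2 = 1 then (opsOf M).val s c.unpair.1.unpair.2.unpair.1 =
    (opsOf M).val s c.unpair.1.unpair.2.unpair.2
  else if c.unpair.2 = 2 then leM ((opsOf M).val s c.unpair.1.unpair.2.unpair.1)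
    ((opsOf M).val s c.unpair.1.unpair.2.unpair.2)
  else if c.unpair.2 = 3 then Sat c.unpair.1.unpair.1 s → Sat c.unpair.1.unpair.2 s
  else if c.unpair.2 = 4 then ∀ x, Sat c.unpair.1 (s ++ [x])
  else False
termination_by c
decreasing_by
  all_goals first
    | exact unpair_fst_lt (by omega)
    | exact unpair_fst_fst_lt (by omega)
    | exact unpair_fst_snd_lt (by omega)

/-- The code of an application of a function symbol. -/
def funCode : ∀ {l : ℕ}, ArithFunc l → (Fin l → ℕ) → ℕ
  | _, .zero, _ => tmZero
  | _, .succ, a => tmSucc (a 0)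
  | _, .add, a => tmAdd (a 0) (a 1)
  | _, .mul, a => tmMul (a 0) (a 1)

/-- The code of an atomic formula. -/
def relCode (k : ℕ) : ∀ {l : ℕ}, ArithRel l → (Fin l → ℕ) → ℕ
  | _, .le, a => fmLe k (a 0) (a 1)

/-- The code of a term. -/
def tmCode {k : ℕ} : LA.Term (Empty ⊕ Fin k) → ℕ
  | .var (.inl e) => e.elim
  | .var (.inr i) => tmVar i
  | .func f ts => funCode f fun i => tmCode (ts i)

/-- The code of a formula. -/
def fmCode : ∀ {k : ℕ}, LA.BoundedFormula Empty k → ℕ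
  | k, .falsum => fmFal k
  | k, .equal t u => fmEq k (tmCode t) (tmCode u)
  | k, .rel R ts => relCode k R fun i => tmCode (ts i)
  | _, .imp φ ψ => fmImp (fmCode φ) (fmCode ψ)
  | _, .all φ => fmAll (fmCode φ)

section codes

variable {k : ℕ}

theorem tmCode_zero (ts : Fin 0 → LA.Term (Empty ⊕ Fin k)) :
    tmCode (.func (L := LA) ArithFunc.zero ts) = tmZero := rfl

theorem tmCode_succ (ts : Fin 1 → LA.Term (Empty ⊕ Fin k)) :
    tmCode (.func (L := LA) ArithFunc.succ ts) = tmSucc (tmCode (ts 0)) := rfl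

theorem tmCode_add (ts : Fin 2 → LA.Term (Empty ⊕ Fin k)) :
    tmCode (.func (L := LA) ArithFunc.add ts) = tmAdd (tmCode (ts 0)) (tmCode (ts 1)) := rfl

theorem tmCode_mul (ts : Fin 2 → LA.Term (Empty ⊕ Fin k)) :
    tmCode (.func (L := LA) ArithFunc.mul ts) = tmMul (tmCode (ts 0)) (tmCode (ts 1)) := rfl

theorem fmCode_le (ts : Fin 2 → LA.Term (Empty ⊕ Fin k)) :
    fmCode (.rel (L := LA) ArithRel.le ts) = fmLe k (tmCode (ts 0)) (tmCode (ts 1)) := rfl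

end codes

/-- `V` is a truth predicate, on codes of formulas with parameters in `D`, for the structure `M`
of which `mk` is an enumeration. -/
structure IsTruth {D M : Type} [LA.Structure M] (o : ArithOps D) (mk : D → M)
    (V : ℕ → List D → Prop) : Prop where
  hom : o.IsHom (opsOf M) mk
  surj : Function.Surjective mk
  fal : ∀ k s, ¬ V (fmFal k) s
  eq : ∀ k a b s, V (fmEq k a b) s ↔ mk (o.val s a) = mk (o.val s b)
  le : ∀ k a b s, V (fmLe k a b) s ↔ leM (mk (o.val s a)) (mk (o.val s b))
  imp : ∀ a b s, V (fmImp a b) s ↔ (V a s → V b s)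
  all : ∀ a s, V (fmAll a) s ↔ ∀ x, V a (s ++ [x])

namespace IsTruth

variable {D M : Type} [LA.Structure M] {o : ArithOps D} {mk : D → M} {V : ℕ → List D → Prop}

theorem mk_val_tmCode (h : IsTruth o mk V) {k : ℕ} (t : LA.Term (Empty ⊕ Fin k)) (s : List D) :
    mk (o.val s (tmCode t)) =
      t.realize (Sum.elim Empty.elim fun i : Fin k => mk (s.getD i o.zero)) := by
  induction t with
  | var a =>
    rcases a with a | i
    · exact a.elim
    · simp [tmCode]
  | func f ts ih =>
    cases f with
    | zero => rw [realize_func_zero, tmCode_zero, ArithOps.val_tmZero, h.hom.zero]; rfl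
    | succ =>
      rw [realize_func_succ, tmCode_succ, ArithOps.val_tmSucc, h.hom.succ, ih]; rfl
    | add =>
      rw [realize_func_add, tmCode_add, ArithOps.val_tmAdd, h.hom.add, ih, ih]; rfl
    | mul =>
      rw [realize_func_mul, tmCode_mul, ArithOps.val_tmMul, h.hom.mul, ih, ih]; rfl

theorem iff_realize (h : IsTruth o mk V) {k : ℕ} (φ : LA.BoundedFormula Empty k) {s : List D}
    (hs : s.length = k) : V (fmCode φ) s ↔
      φ.Realize Empty.elim fun i : Fin k => mk (s.getD i o.zero) := by
  induction φ generalizing s with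
  | falsum => exact iff_of_false (h.fal _ _) id
  | equal t u => rw [fmCode, h.eq, h.mk_val_tmCode, h.mk_val_tmCode]; rfl
  | rel R ts =>
    cases R with
    | le => rw [fmCode_le, h.le, h.mk_val_tmCode, h.mk_val_tmCode, realize_rel_le]
  | imp φ ψ ih₁ ih₂ => rw [fmCode, h.imp, ih₁ hs, ih₂ hs, realize_imp]
  | @all k φ ih =>
    rw [fmCode, h.all, realize_all, h.surj.forall]
    refine forall_congr' fun x => (ih (by simp [hs])).trans (iff_of_eq (congrArg _ ?_))
    funext i
    refine Fin.lastCases ?_ (fun i => ?_) i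
    · simp [← hs]
    · have : (i : ℕ) < s.length := by omega
      simp [List.getElem?_append_left this]

end IsTruth

theorem isTruth_sat (M : Type) [LA.Structure M] : IsTruth (opsOf M) id (Sat (M := M)) where
  hom := ⟨rfl, fun _ => rfl, fun _ _ => rfl, fun _ _ => rfl⟩
  surj := Function.surjective_id
  fal k s := by rw [Sat]; simp [fmFal]
  eq k a b s := by rw [Sat]; simp [fmEq]
  le k a b s := by rw [Sat]; simp [fmLe]
  imp a b s := by rw [Sat]; simp [fmImp]
  all a s := by rw [Sat]; simp [fmAll]

/-! ### Henkin valuations -/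

/-- The free interpretation of the function symbols, on codes of closed terms. -/
def freeOps : ArithOps ℕ := ⟨tmZero, tmSucc, tmAdd, tmMul⟩

/-- The Henkin constant witnessing the failure of `∀ x, a(s, x)`. -/
def henkin (a : ℕ) (s : List ℕ) : ℕ := Nat.pair (Nat.pair a (Encodable.encode s)) 0

/-- The code of the numeral `m̄`. -/
def numCode (m : ℕ) : ℕ := tmSucc^[m] tmZero

/-- The code of `x₀ = x₁`. -/
def eqCode : ℕ := fmEq 2 (tmVar 0) (tmVar 1)

/-- The code of `x₀ ≤ x₁`. -/
def leCode : ℕ := fmLe 2 (tmVar 0) (tmVar 1)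

/-- `V` is the truth predicate of a Henkin structure on the codes of closed terms in which the
sentences with codes in `A` hold and the formula `u` fails at the numeral `m̄`. -/
structure IsHenkin (A : ℕ → Prop) (u m : ℕ) (V : ℕ → List ℕ → Prop) : Prop where
  ax : ∀ a, A a → V a []
  goal : ¬ V u [numCode m]
  fal : ∀ k s, ¬ V (fmFal k) s
  imp : ∀ a b s, V (fmImp a b) s ↔ (V a s → V b s)
  all : ∀ a b s, V (fmAll a) s → V a (s ++ [b])
  wit : ∀ a s, V a (s ++ [henkin a s]) → V (fmAll a) s
  eq : ∀ a b c s, V (fmEq a b c) s ↔ V eqCode [freeOps.val s b, freeOps.val s c]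
  le : ∀ a b c s, V (fmLe a b c) s ↔ V leCode [freeOps.val s b, freeOps.val s c]
  refl : ∀ a, V eqCode [a, a]
  euclid : ∀ a b c, V eqCode [a, b] → V eqCode [c, b] → V eqCode [a, c]
  succ : ∀ a b, V eqCode [a, b] → V eqCode [tmSucc a, tmSucc b]
  add : ∀ a b c d, V eqCode [a, b] → V eqCode [c, d] → V eqCode [tmAdd a c, tmAdd b d]
  mul : ∀ a b c d, V eqCode [a, b] → V eqCode [c, d] → V eqCode [tmMul a c, tmMul b d]
  le_congr : ∀ a b c d, V eqCode [a, b] → V eqCode [c, d] → V leCode [a, c] → V leCode [b, d]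

/-- The structure with given operations and order. -/
@[reducible] def structureOf {D : Type} (o : ArithOps D) (le : D → D → Prop) : LA.Structure D where
  funMap {_} f := match f with
    | ArithFunc.zero => fun _ => o.zero
    | ArithFunc.succ => fun v => o.succ (v 0)
    | ArithFunc.add => fun v => o.add (v 0) (v 1)
    | ArithFunc.mul => fun v => o.mul (v 0) (v 1)
  RelMap {_} r := match r with
    | ArithRel.le => fun v => le (v 0) (v 1)

namespace IsHenkin

variable {A : ℕ → Prop} {u m : ℕ} {V : ℕ → List ℕ → Prop}

theorem symm (h : IsHenkin A u m V) {a b : ℕ} (hab : V eqCode [a, b]) : V eqCode [b, a] :=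
  h.euclid _ _ _ (h.refl b) hab

/-- Equality in the Henkin structure. -/
def setoid (h : IsHenkin A u m V) : Setoid ℕ where
  r a b := V eqCode [a, b]
  iseqv := ⟨h.refl, h.symm, fun hab hbc => h.euclid _ _ _ hab (h.symm hbc)⟩

/-- The operations of the Henkin structure. -/
def ops (h : IsHenkin A u m V) : ArithOps (Quotient h.setoid) where
  zero := Quotient.mk _ tmZero
  succ := Quotient.map tmSucc h.succ
  add := Quotient.map₂ tmAdd fun a b hab c d hcd => h.add a b c d hab hcd
  mul := Quotient.map₂ tmMul fun a b hab c d hcd => h.mul a b c d hab hcd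

/-- The order of the Henkin structure. -/
def order (h : IsHenkin A u m V) : Quotient h.setoid → Quotient h.setoid → Prop :=
  Quotient.lift₂ (fun a b => V leCode [a, b]) fun a c b d hab hcd => propext
    ⟨h.le_congr a b c d hab hcd, h.le_congr b a d c (h.symm hab) (h.symm hcd)⟩

theorem isTruth (h : IsHenkin A u m V) :
    @IsTruth ℕ (Quotient h.setoid) (structureOf h.ops h.order) freeOps (Quotient.mk _) V :=
  letI := structureOf h.ops h.order
  { hom := ⟨rfl, fun _ => rfl, fun _ _ => rfl, fun _ _ => rfl⟩
    surj := Quotient.mk_surjective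
    fal := h.fal
    eq := fun k a b s => (h.eq k a b s).trans
      ⟨fun hE => Quotient.sound hE, fun hE => Quotient.exact hE⟩
    le := fun k a b s => h.le k a b s
    imp := h.imp
    all := fun a s => ⟨fun ha b => h.all a b s ha, fun ha => h.wit a s (ha _)⟩ }

theorem mk_numCode (h : IsHenkin A u m V) (m' : ℕ) :
    letI := structureOf h.ops h.order
    (Quotient.mk h.setoid (numCode m')) = std m' := by
  let := structureOf h.ops h.order
  induction m' with
  | zero => rfl
  | succ m' ih =>
    rw [std_succ, ← ih, numCode, Function.iterate_succ_apply']
    rfl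

end IsHenkin

theorem lt_encode_of_mem {x : ℕ} {s : List ℕ} (h : x ∈ s) : x < Encodable.encode s := by
  induction s with
  | nil => simp at h
  | cons a s ih =>
    rw [Encodable.encode_list_cons]
    rcases List.mem_cons.1 h with rfl | h
    · exact Nat.lt_succ_of_le (Nat.left_le_pair _ _)
    · exact (ih h).trans (Nat.lt_succ_of_le (Nat.right_le_pair _ _))

/-- The interpretation, in a structure, of the codes of closed terms with Henkin constants. -/
noncomputable def interp (M : Type) [LA.Structure M] [Nonempty M] (t : ℕ) : M :=
  if t.unpair.2 = 0 then
    Classical.epsilon fun x => ¬ Sat t.unpair.1.unpair.1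
      (((Denumerable.ofNat (List ℕ) t.unpair.1.unpair.2).attach.map fun y => interp M y.1) ++ [x])
  else if t.unpair.2 = 1 then zeroM
  else if t.unpair.2 = 2 then succM (interp M t.unpair.1)
  else if t.unpair.2 = 3 then
    addM (interp M t.unpair.1.unpair.1) (interp M t.unpair.1.unpair.2)
  else mulM (interp M t.unpair.1.unpair.1) (interp M t.unpair.1.unpair.2)
termination_by t
decreasing_by
  all_goals first
    | exact unpair_fst_lt ‹_›
    | exact unpair_fst_fst_lt ‹_›
    | exact unpair_fst_snd_lt ‹_›
    | exact (lt_encode_of_mem (Subtype.property _)).trans_le (((Denumerable.encode_ofNat _).le.trans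
        (Nat.unpair_right_le _)).trans (Nat.unpair_left_le _))

theorem sat_eqCode (M : Type) [LA.Structure M] (x y : M) : Sat eqCode [x, y] ↔ x = y := by
  rw [eqCode, (isTruth_sat M).eq]; simp

theorem sat_leCode (M : Type) [LA.Structure M] (x y : M) : Sat leCode [x, y] ↔ leM x y := by
  rw [leCode, (isTruth_sat M).le]; simp

section interp

variable (M : Type) [LA.Structure M] [Nonempty M]

theorem isHom_interp : freeOps.IsHom (opsOf M) (interp M) where
  zero := by rw [interp]; simp [freeOps, opsOf, tmZero]
  succ x := by rw [interp]; simp [freeOps, opsOf, tmSucc]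
  add x y := by rw [interp]; simp [freeOps, opsOf, tmAdd]
  mul x y := by rw [interp]; simp [freeOps, opsOf, tmMul]

theorem interp_numCode (m : ℕ) : interp M (numCode m) = std m := by
  induction m with
  | zero => exact ((isHom_interp M).zero).trans std_zero.symm
  | succ m ih =>
    rw [std_succ, ← ih, numCode, Function.iterate_succ_apply']
    exact (isHom_interp M).succ _

theorem sat_of_interp_henkin {a : ℕ} {s : List ℕ}
    (h : Sat a (s.map (interp M) ++ [interp M (henkin a s)])) (x : M) :
    Sat a (s.map (interp M) ++ [x]) := by
  by_contra hx
  refine Classical.epsilon_spec (p := fun x => ¬ Sat a (s.map (interp M) ++ [x])) ⟨x, hx⟩ ?_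
  rw [henkin, interp] at h
  simpa using h

variable {M} in
theorem isHenkin_interp {A : ℕ → Prop} {u m : ℕ} (hA : ∀ a, A a → Sat a ([] : List M))
    (hu : ¬ Sat u [(std m : M)]) : IsHenkin A u m fun c s => Sat c (s.map (interp M)) := by
  have hM := isTruth_sat M
  have he := isHom_interp M
  constructor <;> intros
  · exact hA _ ‹_›
  · simpa [interp_numCode] using hu
  · exact hM.fal _ _
  · exact hM.imp _ _ _
  · rw [List.map_append]; exact (hM.all _ _).1 ‹_› _
  · refine (hM.all _ _).2 (sat_of_interp_henkin M ?_)
    rwa [List.map_append] at *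
  · simp only [List.map_cons, List.map_nil, sat_eqCode, hM.eq, he.map_val, id]
  · simp only [List.map_cons, List.map_nil, sat_leCode, hM.le, he.map_val, id]
  all_goals simp only [List.map_cons, List.map_nil, sat_eqCode, sat_leCode] at *
  · simp_all
  · have := he.succ; simp_all [freeOps]
  · have := he.add; simp_all [freeOps]
  · have := he.mul; simp_all [freeOps]
  · simp_all

end interp

theorem IsTruth.iff_sentence {D M : Type} [LA.Structure M] {o : ArithOps D} {mk : D → M}
    {V : ℕ → List D → Prop} (h : IsTruth o mk V) (φ : LA.Sentence) : V (fmCode φ) [] ↔ M ⊨ φ :=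
  (h.iff_realize φ rfl).trans
    (iff_of_eq (congrArg₂ _ (Subsingleton.elim _ _) (Subsingleton.elim _ _)))

/-! ### The clauses describing Henkin valuations -/

/-- The propositional variable expressing the truth of `c` in the environment `s`. -/
def pos (c : ℕ) (s : List ℕ) : ℕ := Nat.pair c (Encodable.encode s)

/-- The clauses expressing that a valuation is a Henkin valuation, sorted into kinds. -/
def clauses (u m a b c d : ℕ) (s : List ℕ) : List (List (ℕ × Bool)) :=
  [ [(pos a [], true)],
   [(pos u [numCode m], false)],
   [(pos (fmFal a) s, false)],
   [(pos (fmImp a b) s, false), (pos a s, false), (pos b s, true)],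
   [(pos (fmImp a b) s, true), (pos a s, true)],
   [(pos (fmImp a b) s, true), (pos b s, false)],
   [(pos (fmAll a) s, false), (pos a (s ++ [b]), true)],
   [(pos (fmAll a) s, true), (pos a (s ++ [henkin a s]), false)],
   [(pos (fmEq a b c) s, false), (pos eqCode [freeOps.val s b, freeOps.val s c], true)],
   [(pos (fmEq a b c) s, true), (pos eqCode [freeOps.val s b, freeOps.val s c], false)],
   [(pos (fmLe a b c) s, false), (pos leCode [freeOps.val s b, freeOps.val s c], true)],
   [(pos (fmLe a b c) s, true), (pos leCode [freeOps.val s b, freeOps.val s c], false)],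
   [(pos eqCode [a, a], true)],
   [(pos eqCode [a, b], false), (pos eqCode [c, b], false), (pos eqCode [a, c], true)],
   [(pos eqCode [a, b], false), (pos eqCode [tmSucc a, tmSucc b], true)],
   [(pos eqCode [a, b], false), (pos eqCode [c, d], false),
    (pos eqCode [tmAdd a c, tmAdd b d], true)],
   [(pos eqCode [a, b], false), (pos eqCode [c, d], false),
    (pos eqCode [tmMul a c, tmMul b d], true)],
   [(pos eqCode [a, b], false), (pos eqCode [c, d], false), (pos leCode [a, c], false),
    (pos leCode [b, d], true)] ]

/-- A clause which is always satisfied. -/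
def trivialClause : List (ℕ × Bool) := [(0, false), (0, true)]

theorem isHenkin_of_clauses {A : ℕ → Prop} {u m : ℕ} {v : ℕ → Bool}
    (h : ∀ (i a b c d : ℕ) (s : List ℕ), (i = 0 → A a) →
      ∃ l ∈ (clauses u m a b c d s).getD i trivialClause, v l.1 = l.2) :
    IsHenkin A u m fun c s => v (pos c s) = true := by
  constructor
  · intro a ha; simpa [clauses] using h 0 a 0 0 0 [] fun _ => ha
  · simpa [clauses] using h 1 0 0 0 0 [] (by simp)
  · intro k s; simpa [clauses] using h 2 k 0 0 0 s (by simp)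
  · intro a b s
    have h₁ := h 3 a b 0 0 s (by simp)
    have h₂ := h 4 a b 0 0 s (by simp)
    have h₃ := h 5 a b 0 0 s (by simp)
    simp [clauses] at h₁ h₂ h₃
    grind
  · intro a b s; have := h 6 a b 0 0 s (by simp); simp [clauses] at this; grind
  · intro a s; have := h 7 a 0 0 0 s (by simp); simp [clauses] at this; grind
  · intro a b c s
    have h₁ := h 8 a b c 0 s (by simp)
    have h₂ := h 9 a b c 0 s (by simp)
    simp [clauses] at h₁ h₂
    grind
  · intro a b c s
    have h₁ := h 10 a b c 0 s (by simp)
    have h₂ := h 11 a b c 0 s (by simp)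
    simp [clauses] at h₁ h₂
    grind
  · intro a; simpa [clauses] using h 12 a 0 0 0 [] (by simp)
  · intro a b c; have := h 13 a b c 0 [] (by simp); simp [clauses] at this; grind
  · intro a b; have := h 14 a b 0 0 [] (by simp); simp [clauses] at this; grind
  · intro a b c d; have := h 15 a b c d [] (by simp); simp [clauses] at this; grind
  · intro a b c d; have := h 16 a b c d [] (by simp); simp [clauses] at this; grind
  · intro a b c d; have := h 17 a b c d [] (by simp); simp [clauses] at this; grind

open Classical in
theorem IsHenkin.exists_clauses {A : ℕ → Prop} {u m : ℕ} {V : ℕ → List ℕ → Prop}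
    (h : IsHenkin A u m V) : ∃ v : ℕ → Bool, ∀ (i a b c d : ℕ) (s : List ℕ), (i = 0 → A a) →
      ∃ l ∈ (clauses u m a b c d s).getD i trivialClause, v l.1 = l.2 := by
  refine ⟨fun n => decide (V n.unpair.1 (Denumerable.ofNat (List ℕ) n.unpair.2)),
    fun i a b c d s hA => ?_⟩
  rcases lt_or_ge i 18 with hi | hi
  · interval_cases i <;> simp only [clauses, pos, List.getD_cons_zero, List.getD_cons_succ,
      List.exists_mem_cons_iff, List.not_mem_nil, false_and, exists_false, or_false,
      Nat.unpair_pair, Denumerable.ofNat_encode, decide_eq_true_eq, decide_eq_false_iff_not]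
    · exact h.ax a (hA rfl)
    · exact h.goal
    · exact h.fal a s
    · have := h.imp a b s; grind
    · have := h.imp a b s; grind
    · have := h.imp a b s; grind
    · have := h.all a b s; grind
    · have := h.wit a s; grind
    · have := h.eq a b c s; grind
    · have := h.eq a b c s; grind
    · have := h.le a b c s; grind
    · have := h.le a b c s; grind
    · exact h.refl a
    · have := h.euclid a b c; grind
    · have := h.succ a b; grind
    · have := h.add a b c d; grind
    · have := h.mul a b c d; grind
    · have := h.le_congr a b c d; grind
  · rw [List.getD_eq_default _ _ (by simpa [clauses] using hi)]
    simp only [trivialClause, List.exists_mem_cons_iff, decide_eq_true_eq,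
      decide_eq_false_iff_not, List.not_mem_nil, false_and, exists_false, or_false]
    exact (Classical.em _).symm

/-! ### Primitive recursiveness of the clauses -/

theorem primrec_val : Primrec₂ fun (s : List ℕ) (t : ℕ) => freeOps.val s t := by
  have ht : Primrec fun p : List ℕ × List ℕ => p.2.length := Primrec.list_length.comp .snd
  have htag : Primrec fun p : List ℕ × List ℕ => p.2.length.unpair.2 :=
    Primrec.snd.comp (Primrec.unpair.comp ht)
  have hx : Primrec fun p : List ℕ × List ℕ => p.2.length.unpair.1 :=
    Primrec.fst.comp (Primrec.unpair.comp ht)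
  have hget {f : List ℕ × List ℕ → ℕ} (hf : Primrec f) :
      Primrec fun p : List ℕ × List ℕ => p.2.getD (f p) 0 :=
    (Primrec.list_getD 0).comp .snd hf
  have hl := hget (Primrec.fst.comp (Primrec.unpair.comp hx))
  have hr := hget (Primrec.snd.comp (Primrec.unpair.comp hx))
  have hlr := Primrec₂.natPair.comp hl hr
  have htageq (k : ℕ) : PrimrecPred fun p : List ℕ × List ℕ => p.2.length.unpair.2 = k :=
    Primrec.eq.comp htag (.const k)
  refine Primrec.nat_strong_rec _ (g := fun s L => some
    (if L.length.unpair.2 = 0 then s.getD L.length.unpair.1 tmZero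
    else if L.length.unpair.2 = 1 then tmZero
    else if L.length.unpair.2 = 2 then tmSucc (L.getD L.length.unpair.1 0)
    else if L.length.unpair.2 = 3 then
      tmAdd (L.getD L.length.unpair.1.unpair.1 0) (L.getD L.length.unpair.1.unpair.2 0)
    else tmMul (L.getD L.length.unpair.1.unpair.1 0) (L.getD L.length.unpair.1.unpair.2 0)))
    (Primrec.option_some.comp (.ite (htageq 0) ((Primrec.list_getD _).comp .fst hx)
      (.ite (htageq 1) (.const _)
      (.ite (htageq 2) (Primrec₂.natPair.comp (hget hx) (.const 2))
      (.ite (htageq 3) (Primrec₂.natPair.comp hlr (.const 3))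
        (Primrec₂.natPair.comp hlr (.const 4))))))) fun s t => ?_
  conv_rhs => rw [ArithOps.val]
  by_cases h0 : t.unpair.2 = 0
  · simp [h0, freeOps]
  · have h1 := unpair_fst_lt h0
    have h2 := unpair_fst_fst_lt h0
    have h3 := unpair_fst_snd_lt h0
    simp [h0, h1, h2, h3, freeOps]

section primrec

variable {α : Type} [Primcodable α] {f g k : α → ℕ} {s : α → List ℕ}

theorem primrec_pos (hf : Primrec f) (hs : Primrec s) : Primrec fun x => pos (f x) (s x) :=
  Primrec₂.natPair.comp hf (Primrec.encode.comp hs)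

theorem primrec_tmSucc (hf : Primrec f) : Primrec fun x => tmSucc (f x) :=
  Primrec₂.natPair.comp hf (.const 2)

theorem primrec_pair_pair (hf : Primrec f) (hg : Primrec g) (i : ℕ) :
    Primrec fun x => Nat.pair (Nat.pair (f x) (g x)) i :=
  Primrec₂.natPair.comp (Primrec₂.natPair.comp hf hg) (.const i)

theorem primrec_numCode (hf : Primrec f) : Primrec fun x => numCode (f x) :=
  Primrec.nat_iterate hf (.const tmZero) (primrec_tmSucc .snd)

theorem primrec_singleton (hf : Primrec f) : Primrec fun x => [f x] :=
  Primrec.list_cons.comp hf (.const [])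

theorem primrec_pos_two (c : ℕ) (hf : Primrec f) (hg : Primrec g) :
    Primrec fun x => pos c [f x, g x] :=
  primrec_pos (.const c) (Primrec.list_cons.comp hf (primrec_singleton hg))

theorem primrec_clauses (u : ℕ) {m a b c d : α → ℕ} (hm : Primrec m) (ha : Primrec a)
    (hb : Primrec b) (hc : Primrec c) (hd : Primrec d) (hs : Primrec s) :
    Primrec fun x => clauses u (m x) (a x) (b x) (c x) (d x) (s x) := by
  have lit {f : α → ℕ} (hf : Primrec f) (i : Bool) : Primrec fun x => (f x, i) :=
    hf.pair (.const i)
  have cl1 {f : α → ℕ × Bool} (hf : Primrec f) : Primrec fun x => [f x] :=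
    Primrec.list_cons.comp hf (.const [])
  have cl2 {f : α → ℕ × Bool} {l : α → List (ℕ × Bool)} (hf : Primrec f) (hl : Primrec l) :
      Primrec fun x => f x :: l x := Primrec.list_cons.comp hf hl
  have tbl {f : α → List (ℕ × Bool)} {l : α → List (List (ℕ × Bool))} (hf : Primrec f)
      (hl : Primrec l) : Primrec fun x => f x :: l x := Primrec.list_cons.comp hf hl
  have hea := primrec_pos ha hs
  have heb := primrec_pos hb hs
  have himp := primrec_pos (primrec_pair_pair ha hb 3) hs
  have hall := primrec_pos (Primrec₂.natPair.comp ha (.const 4)) hs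
  have hbc := Primrec₂.natPair.comp hb hc
  have heq := primrec_pos (primrec_pair_pair ha hbc 1) hs
  have hle := primrec_pos (primrec_pair_pair ha hbc 2) hs
  have hvb := primrec_val.comp hs hb
  have hvc := primrec_val.comp hs hc
  have happ {f : α → ℕ} (hf : Primrec f) : Primrec fun x => s x ++ [f x] :=
    Primrec.list_append.comp hs (primrec_singleton hf)
  have hhen : Primrec fun x => henkin (a x) (s x) :=
    primrec_pair_pair ha (Primrec.encode.comp hs) 0
  have hE {f g : α → ℕ} (hf : Primrec f) (hg : Primrec g) := primrec_pos_two eqCode hf hg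
  have hL {f g : α → ℕ} (hf : Primrec f) (hg : Primrec g) := primrec_pos_two leCode hf hg
  refine tbl (cl1 (lit (primrec_pos ha (.const [])) _)) ?_
  refine tbl (cl1 (lit (primrec_pos (.const u) (primrec_singleton (primrec_numCode hm))) _)) ?_
  refine tbl (cl1 (lit (primrec_pos (Primrec₂.natPair.comp ha (.const 0)) hs) _)) ?_
  refine tbl (cl2 (lit himp _) (cl2 (lit hea _) (cl1 (lit heb _)))) ?_
  refine tbl (cl2 (lit himp _) (cl1 (lit hea _))) ?_
  refine tbl (cl2 (lit himp _) (cl1 (lit heb _))) ?_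
  refine tbl (cl2 (lit hall _) (cl1 (lit (primrec_pos ha (happ hb)) _))) ?_
  refine tbl (cl2 (lit hall _) (cl1 (lit (primrec_pos ha (happ hhen)) _))) ?_
  refine tbl (cl2 (lit heq _) (cl1 (lit (hE hvb hvc) _))) ?_
  refine tbl (cl2 (lit heq _) (cl1 (lit (hE hvb hvc) _))) ?_
  refine tbl (cl2 (lit hle _) (cl1 (lit (hL hvb hvc) _))) ?_
  refine tbl (cl2 (lit hle _) (cl1 (lit (hL hvb hvc) _))) ?_
  refine tbl (cl1 (lit (hE ha ha) _)) ?_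
  refine tbl (cl2 (lit (hE ha hb) _) (cl2 (lit (hE hc hb) _) (cl1 (lit (hE ha hc) _)))) ?_
  refine tbl (cl2 (lit (hE ha hb) _)
    (cl1 (lit (hE (primrec_tmSucc ha) (primrec_tmSucc hb)) _))) ?_
  refine tbl (cl2 (lit (hE ha hb) _) (cl2 (lit (hE hc hd) _)
    (cl1 (lit (hE (primrec_pair_pair ha hc 3) (primrec_pair_pair hb hd 3)) _)))) ?_
  refine tbl (cl2 (lit (hE ha hb) _) (cl2 (lit (hE hc hd) _)
    (cl1 (lit (hE (primrec_pair_pair ha hc 4) (primrec_pair_pair hb hd 4)) _)))) ?_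
  exact tbl (cl2 (lit (hE ha hb) _) (cl2 (lit (hE hc hd) _) (cl2 (lit (hL ha hc) _)
    (cl1 (lit (hL hb hd) _))))) (.const [])

end primrec

/-- The clause with index `j`. -/
def clauseAt (u m j : ℕ) : List (ℕ × Bool) :=
  (clauses u m j.unpair.1.unpair.1 j.unpair.1.unpair.2.unpair.1
    j.unpair.1.unpair.2.unpair.2.unpair.1 j.unpair.1.unpair.2.unpair.2.unpair.2.unpair.1
    (Denumerable.ofNat (List ℕ) j.unpair.1.unpair.2.unpair.2.unpair.2.unpair.2)).getD
    j.unpair.2 trivialClause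

theorem primrec_clauseAt (u : ℕ) : Primrec₂ (clauseAt u) := by
  have hl {f : ℕ × ℕ → ℕ} (hf : Primrec f) : Primrec fun p => (f p).unpair.1 :=
    Primrec.fst.comp (Primrec.unpair.comp hf)
  have hr {f : ℕ × ℕ → ℕ} (hf : Primrec f) : Primrec fun p => (f p).unpair.2 :=
    Primrec.snd.comp (Primrec.unpair.comp hf)
  have hj : Primrec fun p : ℕ × ℕ => p.2 := .snd
  exact (Primrec.list_getD _).comp (primrec_clauses u .fst (hl (hl hj)) (hl (hr (hl hj)))
    (hl (hr (hr (hl hj)))) (hl (hr (hr (hr (hl hj)))))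
    ((Primrec.ofNat (List ℕ)).comp (hr (hr (hr (hr (hl hj))))))) (hr hj)

theorem exists_isHenkin_iff {A : ℕ → Prop} {u m : ℕ} : (∃ V, IsHenkin A u m V) ↔
    ∃ v : ℕ → Bool, ∀ j ∈ {j : ℕ | j.unpair.2 = 0 → A j.unpair.1.unpair.1},
      ∃ l ∈ clauseAt u m j, v l.1 = l.2 := by
  constructor
  · rintro ⟨V, h⟩
    obtain ⟨v, hv⟩ := h.exists_clauses
    exact ⟨v, fun j hj => hv _ _ _ _ _ _ hj⟩
  · rintro ⟨v, hv⟩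
    refine ⟨_, isHenkin_of_clauses (v := v) fun i a b c d s hA => ?_⟩
    simpa [clauseAt] using
      hv (Nat.pair (Nat.pair a (Nat.pair b (Nat.pair c (Nat.pair d (Encodable.encode s))))) i)
        (by simpa using hA)

/-- Semantic consequence from a `Σₙ₊₁` set of axioms is `Σₙ₊₁`. -/
theorem SigmaPred.consequence {n : ℕ} {T : LA.Theory}
    (hT : SigmaPred (n + 1) fun c => ∃ φ ∈ T, fmCode φ = c)
    (U : LA.BoundedFormula Empty 1) : SigmaPred (n + 1) fun m =>
      ∀ (M : Type) [LA.Structure M] [Nonempty M], M ⊨ T →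
        U.Realize Empty.elim fun _ => (std m : M) := by
  refine (SigmaPred.not_exists_sat (hT.comp (Primrec.fst.comp Primrec.unpair))
    (primrec_clauseAt (fmCode U))).congr fun m => ?_
  refine Iff.trans ?_ (not_congr (exists_isHenkin_iff (A := fun c => ∃ φ ∈ T, fmCode φ = c)))
  rw [iff_not_comm]
  constructor
  · rintro ⟨V, h⟩ hM
    let := structureOf h.ops h.order
    have hV := h.isTruth
    refine h.goal ((hV.iff_realize U rfl).2 ?_)
    convert hM (Quotient h.setoid) ⟨fun φ hφ => ?_⟩ using 2 with i
    · obtain rfl : i = 0 := Subsingleton.elim _ _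
      exact h.mk_numCode m
    · exact (hV.iff_sentence φ).1 (h.ax _ ⟨φ, hφ, rfl⟩)
  · intro h
    push Not at h
    obtain ⟨M, _, _, hM, hU⟩ := h
    refine ⟨_, isHenkin_interp (M := M) ?_ fun hsat => hU ?_⟩
    · rintro _ ⟨φ, hφ, rfl⟩
      exact ((isTruth_sat M).iff_sentence φ).2 (hM.realize_of_mem φ hφ)
    · convert ((isTruth_sat M).iff_realize U rfl).1 hsat using 2 with i
      obtain rfl : i = 0 := Subsingleton.elim _ _
      rfl

/-! ### From codes to Gödel numbers -/

/-- Recursion along the codes of terms and formulas. -/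
def foldCode {σ : Type} [Inhabited σ] (g : ℕ × ℕ → σ × σ × σ → σ) (t : ℕ) : σ :=
  if t.unpair.2 = 0 then g t.unpair default
  else g t.unpair (foldCode g t.unpair.1, foldCode g t.unpair.1.unpair.1,
    foldCode g t.unpair.1.unpair.2)
termination_by t
decreasing_by
  all_goals first
    | exact unpair_fst_lt ‹_›
    | exact unpair_fst_fst_lt ‹_›
    | exact unpair_fst_snd_lt ‹_›

theorem foldCode_zero {σ : Type} [Inhabited σ] (g : ℕ × ℕ → σ × σ × σ → σ) (x : ℕ) :
    foldCode g (Nat.pair x 0) = g (x, 0) default := by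
  rw [foldCode]; simp

theorem foldCode_succ {σ : Type} [Inhabited σ] (g : ℕ × ℕ → σ × σ × σ → σ) (x i : ℕ) :
    foldCode g (Nat.pair x (i + 1)) =
      g (x, i + 1) (foldCode g x, foldCode g x.unpair.1, foldCode g x.unpair.2) := by
  rw [foldCode]; simp

theorem primrec_foldCode {σ : Type} [Inhabited σ] [Primcodable σ] {g : ℕ × ℕ → σ × σ × σ → σ}
    (hg : Primrec₂ g) : Primrec (foldCode g) := by
  have ht : Primrec fun p : Unit × List σ => p.2.length.unpair :=
    Primrec.unpair.comp (Primrec.list_length.comp .snd)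
  have hget {f : Unit × List σ → ℕ} (hf : Primrec f) :
      Primrec fun p : Unit × List σ => p.2.getD (f p) default :=
    (Primrec.list_getD _).comp .snd hf
  have hx := Primrec.fst.comp ht
  have hx' := Primrec.unpair.comp hx
  have : Primrec₂ fun (_ : Unit) t => foldCode g t := by
    refine Primrec.nat_strong_rec _ (g := fun _ L => some
      (if L.length.unpair.2 = 0 then g L.length.unpair default
      else g L.length.unpair (L.getD L.length.unpair.1 default,
        L.getD L.length.unpair.1.unpair.1 default, L.getD L.length.unpair.1.unpair.2 default)))
      (Primrec.option_some.comp (.ite (Primrec.eq.comp (Primrec.snd.comp ht) (.const 0))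
        (hg.comp ht (.const default))
        (hg.comp ht ((hget hx).pair ((hget (Primrec.fst.comp hx')).pair
          (hget (Primrec.snd.comp hx'))))))) fun _ t => ?_
    conv_rhs => rw [foldCode]
    by_cases h0 : t.unpair.2 = 0
    · simp [h0]
    · have h1 := unpair_fst_lt h0
      have h2 := unpair_fst_fst_lt h0
      have h3 := unpair_fst_snd_lt h0
      simp [h0, h1, h2, h3]
  exact this.comp (.const ()) .id

/-- The recursion step of `tmData`. -/
def tmStep (p : ℕ × ℕ) (r : (ℕ × List ℕ) × (ℕ × List ℕ) × (ℕ × List ℕ)) : ℕ × List ℕ :=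
  if p.2 = 0 then (p.1 + 2, [2 * (2 * p.1 + 1)])
  else if p.2 = 1 then (if p.1 = 0 then 1 else 0, [1])
  else if p.2 = 2 then (r.1.1, 3 :: r.1.2)
  else if p.2 = 3 ∨ p.2 = 4 then
    (if r.2.1.1 = 0 ∨ r.2.2.1 = 0 then 0 else max r.2.1.1 r.2.2.1,
      (2 * p.2 - 1) :: (r.2.1.2 ++ r.2.2.2))
  else (0, [])

/-- For the code of a term: the successor of the least number of free variables it can be read
with, and its list of symbols. The first component is `0` if there is no such term. -/
def tmData : ℕ → ℕ × List ℕ := foldCode tmStep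

/-- `c` is the code of a term with free variables among the first `k`. -/
def IsTmCode (k c : ℕ) : Prop := 0 < (tmData c).1 ∧ (tmData c).1 ≤ k + 1

instance (k c : ℕ) : Decidable (IsTmCode k c) := instDecidableAnd

/-- The recursion step of `fmData`. -/
def fmStep (p : ℕ × ℕ) (r : (ℕ × List ℕ) × (ℕ × List ℕ) × (ℕ × List ℕ)) : ℕ × List ℕ :=
  if p.2 = 0 then (p.1 + 1, [2 * (2 * (p.1 + 2) + 1) + 1])
  else if p.2 = 1 ∨ p.2 = 2 then
    (if IsTmCode p.1.unpair.1 p.1.unpair.2.unpair.1 ∧ IsTmCode p.1.unpair.1 p.1.unpair.2.unpair.2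
      then p.1.unpair.1 + 1 else 0,
      (if p.2 = 1 then [] else [1, 2 * (2 * p.1.unpair.1 + 1) + 1]) ++
      [2 * Nat.pair p.1.unpair.1 (Encodable.encode (tmData p.1.unpair.2.unpair.1).2),
        2 * Nat.pair p.1.unpair.1 (Encodable.encode (tmData p.1.unpair.2.unpair.2).2)])
  else if p.2 = 3 then
    (if r.2.1.1 = r.2.2.1 then r.2.1.1 else 0, 3 :: (r.2.1.2 ++ r.2.2.2))
  else if p.2 = 4 then (r.1.1 - 1, 7 :: r.1.2)
  else (0, [])

/-- For the code of a formula: the successor of its number of free variables, and its list of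
symbols. The first component is `0` if there is no such formula. -/
def fmData : ℕ → ℕ × List ℕ := foldCode fmStep

theorem encode_list_map_encode {α : Type} [Encodable α] (l : List α) :
    Encodable.encode (l.map Encodable.encode) = Encodable.encode l := by
  induction l with
  | nil => rfl
  | cons a l ih => simp [Encodable.encode_list_cons, ih]

theorem tmData_var (i : ℕ) : tmData (Nat.pair i 0) = (i + 2, [2 * (2 * i + 1)]) := by
  rw [tmData, foldCode_zero]; simp [tmStep]

theorem tmData_zero (x : ℕ) : tmData (Nat.pair x 1) = (if x = 0 then 1 else 0, [1]) := by
  rw [tmData, foldCode_succ]; simp [tmStep]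

theorem tmData_succ (a : ℕ) : tmData (Nat.pair a 2) = ((tmData a).1, 3 :: (tmData a).2) := by
  rw [tmData, foldCode_succ]; simp [tmStep]

theorem tmData_add (x : ℕ) : tmData (Nat.pair x 3) =
    (if (tmData x.unpair.1).1 = 0 ∨ (tmData x.unpair.2).1 = 0 then 0
      else max (tmData x.unpair.1).1 (tmData x.unpair.2).1,
      5 :: ((tmData x.unpair.1).2 ++ (tmData x.unpair.2).2)) := by
  rw [tmData, foldCode_succ]; simp [tmStep]

theorem tmData_mul (x : ℕ) : tmData (Nat.pair x 4) =
    (if (tmData x.unpair.1).1 = 0 ∨ (tmData x.unpair.2).1 = 0 then 0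
      else max (tmData x.unpair.1).1 (tmData x.unpair.2).1,
      7 :: ((tmData x.unpair.1).2 ++ (tmData x.unpair.2).2)) := by
  rw [tmData, foldCode_succ]; simp [tmStep]

theorem tmData_other (x i : ℕ) : tmData (Nat.pair x (i + 5)) = (0, []) := by
  rw [tmData, foldCode_succ]; simp [tmStep]

theorem tmData_tmCode {k : ℕ} (t : LA.Term (Empty ⊕ Fin k)) :
    IsTmCode k (tmCode t) ∧ (tmData (tmCode t)).2 = t.listEncode.map Encodable.encode := by
  unfold IsTmCode
  induction t with
  | var a =>
    rcases a with a | i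
    · exact a.elim
    · rw [tmCode, tmVar, tmData_var]
      exact ⟨⟨by simp, by simp⟩, rfl⟩
  | func f ts ih =>
    cases f with
    | zero =>
      rw [tmCode_zero, tmZero, tmData_zero]
      exact ⟨by simp, rfl⟩
    | succ =>
      rw [tmCode_succ, tmSucc, tmData_succ, (ih 0).2]
      refine ⟨(ih 0).1, ?_⟩
      simp [Term.listEncode, List.finRange_succ]
      rfl
    | add =>
      have h0 := (ih 0).1
      have h1 := (ih 1).1
      rw [tmCode_add, tmAdd, tmData_add, Nat.unpair_pair, (ih 0).2, (ih 1).2,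
        if_neg (not_or.2 ⟨h0.1.ne', h1.1.ne'⟩)]
      refine ⟨⟨lt_max_of_lt_left h0.1, max_le h0.2 h1.2⟩, ?_⟩
      simp [Term.listEncode, List.finRange_succ]
      rfl
    | mul =>
      have h0 := (ih 0).1
      have h1 := (ih 1).1
      rw [tmCode_mul, tmMul, tmData_mul, Nat.unpair_pair, (ih 0).2, (ih 1).2,
        if_neg (not_or.2 ⟨h0.1.ne', h1.1.ne'⟩)]
      refine ⟨⟨lt_max_of_lt_left h0.1, max_le h0.2 h1.2⟩, ?_⟩
      simp [Term.listEncode, List.finRange_succ]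
      rfl

theorem exists_tmCode_eq {k c : ℕ} (h : IsTmCode k c) :
    ∃ t : LA.Term (Empty ⊕ Fin k), tmCode t = c := by
  unfold IsTmCode at h
  induction c using Nat.strong_induction_on with
  | _ c ih =>
    obtain ⟨x, i, rfl⟩ : ∃ x i, c = Nat.pair x i := ⟨_, _, (Nat.pair_unpair c).symm⟩
    have hx (hi : i ≠ 0) : x < Nat.pair x i := by
      simpa using unpair_fst_lt (t := Nat.pair x i) (by simpa)
    rcases i with _ | _ | _ | _ | _ | i
    · rw [tmData_var] at h
      exact ⟨.var (.inr ⟨x, by simp at h; omega⟩), rfl⟩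
    · rw [tmData_zero] at h
      obtain rfl : x = 0 := by by_contra hx; simp [hx] at h
      exact ⟨.func (L := LA) ArithFunc.zero ![], rfl⟩
    · rw [tmData_succ] at h
      obtain ⟨t, rfl⟩ := ih x (hx (by simp)) h
      exact ⟨succT t, rfl⟩
    · rw [tmData_add] at h
      have hx := hx (by simp)
      simp only at h
      split_ifs at h with h'
      · simp at h
      obtain ⟨t, ht⟩ := ih x.unpair.1 ((Nat.unpair_left_le x).trans_lt hx) (by omega)
      obtain ⟨u, hu⟩ := ih x.unpair.2 ((Nat.unpair_right_le x).trans_lt hx) (by omega)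
      exact ⟨addT t u, by
        rw [addT, tmCode_add]; simp [tmAdd, ht, hu]⟩
    · rw [tmData_mul] at h
      have hx := hx (by simp)
      simp only at h
      split_ifs at h with h'
      · simp at h
      obtain ⟨t, ht⟩ := ih x.unpair.1 ((Nat.unpair_left_le x).trans_lt hx) (by omega)
      obtain ⟨u, hu⟩ := ih x.unpair.2 ((Nat.unpair_right_le x).trans_lt hx) (by omega)
      exact ⟨mulT t u, by
        rw [mulT, tmCode_mul]; simp [tmMul, ht, hu]⟩
    · rw [tmData_other] at h
      simp at h

theorem fmData_fal (k : ℕ) :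
    fmData (Nat.pair k 0) = (k + 1, [2 * (2 * (k + 2) + 1) + 1]) := by
  rw [fmData, foldCode_zero]; simp [fmStep]

theorem fmData_eq (x : ℕ) : fmData (Nat.pair x 1) =
    (if IsTmCode x.unpair.1 x.unpair.2.unpair.1 ∧ IsTmCode x.unpair.1 x.unpair.2.unpair.2
      then x.unpair.1 + 1 else 0,
      [2 * Nat.pair x.unpair.1 (Encodable.encode (tmData x.unpair.2.unpair.1).2),
        2 * Nat.pair x.unpair.1 (Encodable.encode (tmData x.unpair.2.unpair.2).2)]) := by
  rw [fmData, foldCode_succ]; simp [fmStep]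

theorem fmData_le (x : ℕ) : fmData (Nat.pair x 2) =
    (if IsTmCode x.unpair.1 x.unpair.2.unpair.1 ∧ IsTmCode x.unpair.1 x.unpair.2.unpair.2
      then x.unpair.1 + 1 else 0,
      [1, 2 * (2 * x.unpair.1 + 1) + 1,
        2 * Nat.pair x.unpair.1 (Encodable.encode (tmData x.unpair.2.unpair.1).2),
        2 * Nat.pair x.unpair.1 (Encodable.encode (tmData x.unpair.2.unpair.2).2)]) := by
  rw [fmData, foldCode_succ]; simp [fmStep]

theorem fmData_imp (x : ℕ) : fmData (Nat.pair x 3) =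
    (if (fmData x.unpair.1).1 = (fmData x.unpair.2).1 then (fmData x.unpair.1).1 else 0,
      3 :: ((fmData x.unpair.1).2 ++ (fmData x.unpair.2).2)) := by
  rw [fmData, foldCode_succ]; simp [fmStep]

theorem fmData_all (x : ℕ) :
    fmData (Nat.pair x 4) = ((fmData x).1 - 1, 7 :: (fmData x).2) := by
  rw [fmData, foldCode_succ]; simp [fmStep]

theorem fmData_other (x i : ℕ) : fmData (Nat.pair x (i + 5)) = (0, []) := by
  rw [fmData, foldCode_succ]; simp [fmStep]

theorem encode_term {k : ℕ} (t : LA.Term (Empty ⊕ Fin k)) :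
    Encodable.encode (tmData (tmCode t)).2 = Encodable.encode t := by
  rw [(tmData_tmCode t).2, encode_list_map_encode]; rfl

theorem fmData_fmCode {k : ℕ} (φ : LA.BoundedFormula Empty k) :
    fmData (fmCode φ) = (k + 1, φ.listEncode.map Encodable.encode) := by
  induction φ with
  | falsum => rw [fmCode, fmFal, fmData_fal]; rfl
  | equal t u =>
    rw [fmCode, fmEq, fmData_eq]
    simp only [Nat.unpair_pair]
    rw [if_pos ⟨(tmData_tmCode t).1, (tmData_tmCode u).1⟩]
    simp [BoundedFormula.listEncode, encode_term]
  | rel R ts =>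
    cases R with
    | le =>
      rw [fmCode_le, fmLe, fmData_le]
      simp only [Nat.unpair_pair]
      rw [if_pos ⟨(tmData_tmCode (ts 0)).1, (tmData_tmCode (ts 1)).1⟩]
      rw [encode_term, encode_term]
      rfl
  | imp φ ψ ih₁ ih₂ =>
    rw [fmCode, fmImp, fmData_imp]
    simp only [Nat.unpair_pair, ih₁, ih₂]
    simp [BoundedFormula.listEncode]
  | all φ ih =>
    rw [fmCode, fmAll, fmData_all, ih]
    simp [BoundedFormula.listEncode]

theorem exists_fmCode_eq {k c : ℕ} (h : (fmData c).1 = k + 1) :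
    ∃ φ : LA.BoundedFormula Empty k, fmCode φ = c := by
  induction c using Nat.strong_induction_on generalizing k with
  | _ c ih =>
    obtain ⟨x, i, rfl⟩ : ∃ x i, c = Nat.pair x i := ⟨_, _, (Nat.pair_unpair c).symm⟩
    have hx (hi : i ≠ 0) : x < Nat.pair x i := by
      simpa using unpair_fst_lt (t := Nat.pair x i) (by simpa)
    rcases i with _ | _ | _ | _ | _ | i
    · rw [fmData_fal] at h
      obtain rfl : x = k := by simpa using h
      exact ⟨.falsum, rfl⟩
    · rw [fmData_eq] at h
      simp only at h
      split_ifs at h with h'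
      obtain ⟨⟨t, ht⟩, ⟨u, hu⟩⟩ := And.intro (exists_tmCode_eq h'.1) (exists_tmCode_eq h'.2)
      obtain rfl : x.unpair.1 = k := by simpa using h
      exact ⟨.equal t u, by rw [fmCode, ht, hu]; simp [fmEq]⟩
    · rw [fmData_le] at h
      simp only at h
      split_ifs at h with h'
      obtain ⟨⟨t, ht⟩, ⟨u, hu⟩⟩ := And.intro (exists_tmCode_eq h'.1) (exists_tmCode_eq h'.2)
      obtain rfl : x.unpair.1 = k := by simpa using h
      exact ⟨leF t u, by rw [leF, fmCode_le]; simp [fmLe, ht, hu]⟩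
    · rw [fmData_imp] at h
      have hx := hx (by simp)
      simp only at h
      split_ifs at h with h'
      obtain ⟨φ, hφ⟩ := ih x.unpair.1 ((Nat.unpair_left_le x).trans_lt hx) h
      obtain ⟨ψ, hψ⟩ := ih x.unpair.2 ((Nat.unpair_right_le x).trans_lt hx) (h' ▸ h)
      exact ⟨.imp φ ψ, by simp [fmCode, fmImp, hφ, hψ]⟩
    · rw [fmData_all] at h
      obtain ⟨φ, rfl⟩ := ih x (hx (by simp)) (k := k + 1) (by simp at h; omega)
      exact ⟨.all φ, rfl⟩
    · rw [fmData_other] at h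
      simp at h

theorem primrec_tmData : Primrec tmData := by
  have hp : Primrec fun q : (ℕ × ℕ) × (ℕ × List ℕ) × (ℕ × List ℕ) × (ℕ × List ℕ) => q.1 := .fst
  have htag (i : ℕ) : PrimrecPred
      fun q : (ℕ × ℕ) × (ℕ × List ℕ) × (ℕ × List ℕ) × (ℕ × List ℕ) => q.1.2 = i :=
    Primrec.eq.comp (Primrec.snd.comp hp) (.const i)
  have hx := Primrec.fst.comp hp
  have hr : Primrec fun q : (ℕ × ℕ) × (ℕ × List ℕ) × (ℕ × List ℕ) × (ℕ × List ℕ) => q.2 := .snd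
  have hr₀ := Primrec.fst.comp hr
  have hr₁ := Primrec.fst.comp (Primrec.snd.comp hr)
  have hr₂ := Primrec.snd.comp (Primrec.snd.comp hr)
  have hb₁ := Primrec.fst.comp hr₁
  have hb₂ := Primrec.fst.comp hr₂
  have htwo {f : (ℕ × ℕ) × (ℕ × List ℕ) × (ℕ × List ℕ) × (ℕ × List ℕ) → ℕ} (hf : Primrec f) :
      Primrec fun q => 2 * f q := Primrec.nat_mul.comp (.const 2) hf
  refine primrec_foldCode ?_
  refine .ite (htag 0) (.pair (Primrec.nat_add.comp hx (.const 2)) (primrec_singleton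
    (htwo (Primrec.succ.comp (htwo hx))))) ?_
  refine .ite (htag 1) (.pair (.ite (Primrec.eq.comp hx (.const 0)) (.const 1) (.const 0))
    (.const [1])) ?_
  refine .ite (htag 2) (.pair (Primrec.fst.comp hr₀)
    (Primrec.list_cons.comp (.const 3) (Primrec.snd.comp hr₀))) ?_
  exact .ite ((htag 3).or (htag 4)) (.pair (.ite
    ((Primrec.eq.comp hb₁ (.const 0)).or (Primrec.eq.comp hb₂ (.const 0))) (.const 0)
    (Primrec.nat_max.comp hb₁ hb₂)) (Primrec.list_cons.comp
      (Primrec.nat_sub.comp (htwo (Primrec.snd.comp hp)) (.const 1))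
      (Primrec.list_append.comp (Primrec.snd.comp hr₁) (Primrec.snd.comp hr₂)))) (.const _)

theorem primrec_fmData : Primrec fmData := by
  have hp : Primrec fun q : (ℕ × ℕ) × (ℕ × List ℕ) × (ℕ × List ℕ) × (ℕ × List ℕ) => q.1 := .fst
  have htag (i : ℕ) : PrimrecPred
      fun q : (ℕ × ℕ) × (ℕ × List ℕ) × (ℕ × List ℕ) × (ℕ × List ℕ) => q.1.2 = i :=
    Primrec.eq.comp (Primrec.snd.comp hp) (.const i)
  have hx := Primrec.fst.comp hp
  have hr : Primrec fun q : (ℕ × ℕ) × (ℕ × List ℕ) × (ℕ × List ℕ) × (ℕ × List ℕ) => q.2 := .snd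
  have hr₀ := Primrec.fst.comp hr
  have hr₁ := Primrec.fst.comp (Primrec.snd.comp hr)
  have hr₂ := Primrec.snd.comp (Primrec.snd.comp hr)
  have hb₁ := Primrec.fst.comp hr₁
  have hb₂ := Primrec.fst.comp hr₂
  have htwo {f : (ℕ × ℕ) × (ℕ × List ℕ) × (ℕ × List ℕ) × (ℕ × List ℕ) → ℕ} (hf : Primrec f) :
      Primrec fun q => 2 * f q := Primrec.nat_mul.comp (.const 2) hf
  have hodd {f : (ℕ × ℕ) × (ℕ × List ℕ) × (ℕ × List ℕ) × (ℕ × List ℕ) → ℕ} (hf : Primrec f) :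
      Primrec fun q => 2 * f q + 1 := Primrec.succ.comp (htwo hf)
  have hk := Primrec.fst.comp (Primrec.unpair.comp hx)
  have hts := Primrec.unpair.comp (Primrec.snd.comp (Primrec.unpair.comp hx))
  have ht := primrec_tmData.comp (Primrec.fst.comp hts)
  have hu := primrec_tmData.comp (Primrec.snd.comp hts)
  have hk' := Primrec.succ.comp hk
  have hvalid {f : (ℕ × ℕ) × (ℕ × List ℕ) × (ℕ × List ℕ) × (ℕ × List ℕ) → ℕ × List ℕ}
      (hf : Primrec f) := (Primrec.nat_lt.comp (.const 0) (Primrec.fst.comp hf)).and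
        (Primrec.nat_le.comp (Primrec.fst.comp hf) hk')
  have htok {f : (ℕ × ℕ) × (ℕ × List ℕ) × (ℕ × List ℕ) × (ℕ × List ℕ) → ℕ × List ℕ}
      (hf : Primrec f) :=
    htwo (Primrec₂.natPair.comp hk (Primrec.encode.comp (Primrec.snd.comp hf)))
  refine primrec_foldCode ?_
  refine .ite (htag 0) (.pair (Primrec.succ.comp hx) (primrec_singleton
    (hodd (hodd (Primrec.nat_add.comp hx (.const 2)))))) ?_
  refine .ite ((htag 1).or (htag 2)) (.pair (.ite ((hvalid ht).and (hvalid hu)) hk' (.const 0))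
    (Primrec.list_append.comp (.ite (htag 1) (.const [])
      (Primrec.list_cons.comp (.const 1) (primrec_singleton (hodd (hodd hk)))))
      (Primrec.list_cons.comp (htok ht) (primrec_singleton (htok hu))))) ?_
  refine .ite (htag 3) (.pair (.ite (Primrec.eq.comp hb₁ hb₂) hb₁ (.const 0))
    (Primrec.list_cons.comp (.const 3)
      (Primrec.list_append.comp (Primrec.snd.comp hr₁) (Primrec.snd.comp hr₂)))) ?_
  exact .ite (htag 4) (.pair (Primrec.nat_sub.comp (Primrec.fst.comp hr₀) (.const 1))
    (Primrec.list_cons.comp (.const 7) (Primrec.snd.comp hr₀))) (.const _)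

theorem godel_injective : Function.Injective (godel : LA.Sentence → ℕ) := fun φ ψ h => by
  have := @BoundedFormula.listEncode_sigma_injective LA Empty ⟨0, φ⟩ ⟨0, ψ⟩
    (Encodable.encode_injective h)
  simpa using this

theorem mem_axioms_iff {T : LA.Theory} {c : ℕ} : (∃ φ ∈ T, fmCode φ = c) ↔
    (fmData c).1 = 1 ∧ Encodable.encode (fmData c).2 ∈ axiomCodes T := by
  constructor
  · rintro ⟨φ, hφ, rfl⟩
    rw [fmData_fmCode]
    exact ⟨rfl, φ, hφ, (encode_list_map_encode _).symm⟩
  · rintro ⟨h₁, ψ, hψ, hc⟩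
    obtain ⟨φ, rfl⟩ := exists_fmCode_eq h₁
    rw [fmData_fmCode, encode_list_map_encode] at hc
    exact ⟨φ, godel_injective hc ▸ hψ, rfl⟩

theorem SigmaDefinable.sigmaPred_axioms {n : ℕ} {T : LA.Theory}
    (h : SigmaDefinable n (axiomCodes T)) : SigmaPred n fun c => ∃ φ ∈ T, fmCode φ = c :=
  ((SigmaPred.of_primrecPred (Primrec.eq.comp (Primrec.fst.comp primrec_fmData) (.const 1))).and
    (h.sigmaPred.comp (Primrec.encode.comp (Primrec.snd.comp primrec_fmData)))).congr
    fun _ => mem_axioms_iff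

/-- **Corollary 2.10.** No `n`-consistent and `Σₙ`-definable (`n ≥ 1`)
extension of `Q` is `Πₙ`-deciding. -/
theorem nconsistent_sigmaDefinable_not_piDeciding (n : ℕ) (hn : 1 ≤ n)
    (T : LA.Theory) (hQ : ExtendsQ T) (hcon : NCon n T)
    (hdef : SigmaDefinable n (axiomCodes T)) :
    ∃ γ : LA.Sentence, IsPi n γ ∧ ¬ Proves T γ ∧ ¬ Proves T (∼γ) := by
  obtain ⟨n, rfl⟩ := Nat.exists_eq_add_of_le' hn
  by_contra hdec
  have hdec (γ : LA.Sentence) (hγ : IsPi (n + 1) γ) : Proves T γ ∨ Proves T (∼γ) := by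
    by_contra h
    exact hdec ⟨γ, hγ, not_or.1 h⟩
  obtain ⟨p, hp, hp'⟩ := SigmaPred.exists_not_compl n
  obtain ⟨U, hU⟩ := hp.exists_represents_compl hQ hcon hdec
  exact hp' ((SigmaPred.consequence hdef.sigmaPred_axioms U).congr hU)

end GRNonRE
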